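/- arXiv:1501.06362 — 2 statements merged into one kernel-verified Lean document; each statement's English description precedes it below -/
import Mathlib

section
/- Let k be an algebraically closed field of characteristic zero and let G be a finite group. Then there exists a commutative finitely generated k-algebra A which is an integral domain, is smooth over k, and has Krull dimension 1 (i.e. A is the coordinate ring of a smooth affine curve), such that the group of k-algebra automorphisms of A is isomorphic to G. -/
open Polynomial

theorem PowerSeries.constantCoeff_eval {k : Type*} [CommRing k] (f : (PowerSeries k)[X])
    (w : PowerSeries k) : PowerSeries.constantCoeff (f.eval w) =
      (f.map PowerSeries.constantCoeff).eval (PowerSeries.constantCoeff w) := by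
  rw [Polynomial.eval_map_apply]

/-- Hensel lifting of simple roots for power series. -/
theorem PowerSeries.exists_isRoot_of_simple {k : Type*} [Field k] {f : (PowerSeries k)[X]}
    (hf : f.Monic) {a : k} (h0 : (f.map PowerSeries.constantCoeff).eval a = 0)
    (h1 : (f.map PowerSeries.constantCoeff).derivative.eval a ≠ 0) :
    ∃ w : PowerSeries k, f.eval w = 0 ∧ PowerSeries.constantCoeff w = a := by
  have hmem : ∀ x : PowerSeries k, x ∈ Ideal.span {(PowerSeries.X : PowerSeries k)} ↔
      PowerSeries.constantCoeff x = 0 := fun x ↦ by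
    rw [Ideal.mem_span_singleton, PowerSeries.X_dvd_iff]
  obtain ⟨w, hw, hw'⟩ := HenselianRing.is_henselian
    (I := Ideal.span {(PowerSeries.X : PowerSeries k)}) f hf (PowerSeries.C a)
    (by rw [hmem, constantCoeff_eval]; simpa using h0)
    (by
      refine IsUnit.map _ (PowerSeries.isUnit_iff_constantCoeff.mpr ?_)
      rw [constantCoeff_eval, ← derivative_map]
      simpa using h1)
  refine ⟨w, hw, ?_⟩
  rw [hmem] at hw'
  simpa [sub_eq_zero] using hw'

theorem PowerSeries.isRoot_unique_of_simple {k : Type*} [Field k] {f : (PowerSeries k)[X]}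
    {a : k} (h1 : (f.map PowerSeries.constantCoeff).derivative.eval a ≠ 0)
    {v w : PowerSeries k} (hv : f.eval v = 0) (hw : f.eval w = 0)
    (hva : PowerSeries.constantCoeff v = a) (hwa : PowerSeries.constantCoeff w = a) : v = w := by
  obtain ⟨c, hc⟩ := Polynomial.binomExpansion f v (w - v)
  rw [add_sub_cancel, hv, hw] at hc
  have h : (w - v) * (f.derivative.eval v + c * (w - v)) = 0 := by linear_combination -hc
  rcases mul_eq_zero.mp h with h | h
  · exact (sub_eq_zero.mp h).symm
  · refine absurd ?_ h1
    have := congrArg PowerSeries.constantCoeff h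
    rw [map_add, constantCoeff_eval, ← derivative_map, hva] at this
    simpa [hva, hwa] using this

/-- The evaluation embedding `k(t) → Frac k⟦X⟧`. -/
noncomputable def RatFunc.toFracPowerSeries {k : Type*} [Field k] (w : PowerSeries k)
    (hw : Transcendental k w) : RatFunc k →ₐ[k] FractionRing (PowerSeries k) :=
  IsFractionRing.liftAlgHom (A := k[X])
    (g := (IsScalarTower.toAlgHom k (PowerSeries k) (FractionRing (PowerSeries k))).comp
      (Polynomial.aeval w))
    (by
      rw [AlgHom.coe_comp]
      exact (IsFractionRing.injective (PowerSeries k) (FractionRing (PowerSeries k))).comp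
        (transcendental_iff_injective.mp hw))

theorem RatFunc.toFracPowerSeries_X {k : Type*} [Field k] (w : PowerSeries k)
    (hw : Transcendental k w) : RatFunc.toFracPowerSeries w hw RatFunc.X = algebraMap _ _ w := by
  rw [RatFunc.toFracPowerSeries, ← RatFunc.algebraMap_X, IsFractionRing.liftAlgHom_apply,
    IsFractionRing.lift_algebraMap]
  simp

theorem PowerSeries.transcendental_coe {k : Type*} [Field k] (q : k[X]) (hq : q.natDegree ≠ 0) :
    Transcendental k (q : PowerSeries k) := by
  rw [transcendental_iff]
  intro P hP
  have : Polynomial.aeval (q : PowerSeries k) P = ((P.comp q : k[X]) : PowerSeries k) := by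
    rw [← Polynomial.coeToPowerSeries.ringHom_apply, ← Polynomial.coeToPowerSeries.ringHom_apply,
      Polynomial.comp, Polynomial.hom_eval₂, Polynomial.aeval_def]
    congr 1
    ext c
    simp
  rw [this, Polynomial.coe_eq_zero_iff, Polynomial.comp_eq_zero_iff] at hP
  rcases hP with hP | ⟨-, h⟩
  · exact hP
  · rw [h] at hq; simp at hq

theorem Polynomial.splits_map_fractionRing {W : Type*} [CommRing W] [IsDomain W] {f : W[X]}
    (hf : f.Monic) (S : Finset W) (hS : S.card = f.natDegree) (hroot : ∀ w ∈ S, f.eval w = 0) :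
    (f.map (algebraMap W (FractionRing W))).Splits ∧ ∀ z : FractionRing W,
      (f.map (algebraMap W (FractionRing W))).eval z = 0 → ∃ w ∈ S, algebraMap _ _ w = z := by
  have h1 : f.roots = S.val := by
    have hle : S.val ≤ f.roots := by
      rw [Multiset.le_iff_subset S.nodup]
      intro w hw
      exact (Polynomial.mem_roots hf.ne_zero).mpr (hroot w hw)
    refine (Multiset.eq_of_le_of_card_le hle ?_).symm
    exact (Polynomial.card_roots' f).trans hS.ge
  have h2 : f.map (algebraMap W (FractionRing W)) =
      ∏ w ∈ S, (X - C (algebraMap W (FractionRing W) w)) := by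
    rw [← Polynomial.prod_multiset_X_sub_C_of_monic_of_roots_card_eq hf (by rw [h1]; exact hS)]
    rw [Polynomial.map_multiset_prod, h1, Multiset.map_map]
    rw [Finset.prod_eq_multiset_prod]
    congr 2
    funext w
    simp
  rw [h2]
  refine ⟨Polynomial.Splits.prod fun w _ ↦ Polynomial.Splits.X_sub_C _, fun z hz ↦ ?_⟩
  rw [eval_prod, Finset.prod_eq_zero_iff] at hz
  obtain ⟨w, hw, h⟩ := hz
  exact ⟨w, hw, by simpa using (sub_eq_zero.mp (by simpa using h)).symm⟩

theorem Polynomial.Gal.galActionHom_bijective_of_swap {F E : Type*} [Field F] [CharZero F] [Field E]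
    [Algebra F E] {f : F[X]} (hirr : Irreducible f) (hdeg : f.natDegree.Prime)
    [hsp : Fact ((f.map (algebraMap F E)).Splits)] (ϕ : E ≃ₐ[F] E) (x y : E)
    (hx : x ∈ f.rootSet E) (hxy : x ≠ y) (hϕx : ϕ x = y) (hϕy : ϕ y = x)
    (hϕ : ∀ z ∈ f.rootSet E, z ≠ x → z ≠ y → ϕ z = z) :
    Function.Bijective (Gal.galActionHom f E) := by
  classical
  have hy : y ∈ f.rootSet E := by
    rw [Polynomial.mem_rootSet] at hx ⊢
    refine ⟨hx.1, ?_⟩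
    rw [← hϕx, ← AlgEquiv.coe_toAlgHom, Polynomial.aeval_algHom_apply, hx.2, map_zero]
  have h1 : Fintype.card (f.rootSet E) = f.natDegree := by
    simp_rw [rootSet_def, Finset.coe_sort_coe, Fintype.card_coe]
    rw [Multiset.toFinset_card_of_nodup, ← Splits.natDegree_eq_card_roots, natDegree_map]
    · exact hsp.1
    · exact nodup_roots ((separable_map (algebraMap F E)).mpr hirr.separable)
  refine
    ⟨Gal.galActionHom_injective f E, fun σ =>
      (congr_arg (σ ∈ ·) (show (Gal.galActionHom f E).range = ⊤ from ?_)).mpr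
        (Subgroup.mem_top σ)⟩
  apply Equiv.Perm.subgroup_eq_top_of_swap_mem
    (τ := Gal.galActionHom f E (Gal.restrict f E ϕ))
  · rwa [h1]
  · rw [h1]
    simpa only [Fintype.card_eq_nat_card,
      Nat.card_congr (MonoidHom.ofInjective (Gal.galActionHom_injective f E)).toEquiv.symm]
      using Gal.prime_degree_dvd_card hirr hdeg
  · exact ⟨_, rfl⟩
  · refine ⟨⟨x, hx⟩, ⟨y, hy⟩, by simpa using hxy, ?_⟩
    ext z
    rw [Gal.galActionHom_restrict]
    by_cases hzx : z = ⟨x, hx⟩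
    · subst hzx; simp [hϕx]
    by_cases hzy : z = ⟨y, hy⟩
    · subst hzy; simp [hϕy]
    rw [Equiv.swap_apply_of_ne_of_ne hzx hzy]
    exact hϕ z z.2 (fun h ↦ hzx (Subtype.ext h)) (fun h ↦ hzy (Subtype.ext h))

theorem Group.exists_injective_not_surjective_hom {G Γ α : Type*} [Group G] [Finite G] [Group Γ]
    [Finite Γ] [Finite α]
    (e : Γ ≃* Equiv.Perm α) (hα : Nat.card G ≤ Nat.card α) (hΓ : Nat.card G < Nat.card Γ) :
    ∃ ρ : G →* Γ, Function.Injective ρ ∧ ¬ Function.Surjective ρ := by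
  have := Fintype.ofFinite G
  have := Fintype.ofFinite α
  obtain ⟨i⟩ : Nonempty (G ↪ α) := by
    rw [Function.Embedding.nonempty_iff_card_le]
    simpa [Nat.card_eq_fintype_card] using hα
  refine ⟨e.symm.toMonoidHom.comp
    ((Equiv.Perm.viaEmbeddingHom i).comp (MulAction.toPermHom G G)), ?_, ?_⟩
  · simp only [MonoidHom.coe_comp]
    exact e.symm.injective.comp
      ((Equiv.Perm.viaEmbeddingHom_injective i).comp MulAction.toPerm_injective)
  · intro h
    exact absurd (Nat.card_le_card_of_surjective _ h) (not_le.mpr hΓ)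

/-- The trinomial `Y ^ p - Y ^ 2 + a`. -/
noncomputable def trinomialSq {R : Type*} [CommRing R] (p : ℕ) (a : R) : R[X] :=
  X ^ p - X ^ 2 + C a

section
variable {R S : Type*} [CommRing R] [CommRing S] (p : ℕ) (a : R)

theorem trinomialSq_eq : trinomialSq p a = X ^ p + (C a - X ^ 2) := by rw [trinomialSq]; ring

theorem trinomialSq_map (f : R →+* S) : (trinomialSq p a).map f = trinomialSq p (f a) := by
  simp [trinomialSq]

theorem trinomialSq_eval (x : R) : (trinomialSq p a).eval x = x ^ p - x ^ 2 + a := by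
  simp [trinomialSq]

theorem trinomialSq_derivative_eval (x : R) :
    (trinomialSq p a).derivative.eval x = p * x ^ (p - 1) - 2 * x := by
  simp [trinomialSq, derivative_X_pow, ← one_add_one_eq_two]

variable {p}

theorem trinomialSq_degree_aux (hp : 3 ≤ p) : (C a - X ^ 2 : R[X]).degree < (p : ℕ) := by
  refine lt_of_le_of_lt (b := ((2 : ℕ) : WithBot ℕ)) ?_ (by exact_mod_cast hp)
  refine (degree_sub_le _ _).trans (max_le ?_ (degree_X_pow_le _))
  exact degree_C_le.trans (by norm_num)

theorem trinomialSq_monic (hp : 3 ≤ p) : (trinomialSq p a).Monic := by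
  rw [trinomialSq_eq]
  exact monic_X_pow_add (trinomialSq_degree_aux a hp)

theorem trinomialSq_natDegree [Nontrivial R] (hp : 3 ≤ p) : (trinomialSq p a).natDegree = p := by
  rw [trinomialSq_eq]
  apply natDegree_eq_of_degree_eq_some
  rw [degree_add_eq_left_of_degree_lt, degree_X_pow]
  rw [degree_X_pow]
  exact trinomialSq_degree_aux a hp

end

theorem trinomialSq_irreducible_polynomial {k : Type*} [Field k] {p : ℕ} :
    Irreducible (trinomialSq p (1 - X : k[X])) := by
  rw [← MulEquiv.irreducible_iff (Bivariate.swap (R := k))]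
  have : Bivariate.swap (trinomialSq p (1 - X : k[X])) =
      -(X - C (trinomialSq p (1 : k))) := by
    simp [trinomialSq, Bivariate.swap_X, Bivariate.swap_Y]
    ring
  rw [this]
  exact Associated.irreducible ⟨-1, mul_neg_one _⟩ (irreducible_X_sub_C _)

theorem trinomialSq_irreducible {k : Type*} [Field k] {p : ℕ} (hp : 3 ≤ p) :
    Irreducible (trinomialSq p (1 - RatFunc.X : RatFunc k)) := by
  have := ((trinomialSq_monic (1 - X : k[X]) hp).irreducible_iff_irreducible_map_fraction_map
    (K := RatFunc k)).mp trinomialSq_irreducible_polynomial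
  rw [trinomialSq_map] at this
  simpa using this

theorem trinomialSq_derivative_eval_ne_zero {k : Type*} [Field k] [CharZero k] {p : ℕ} (hp : 5 ≤ p)
    (c : k) (hc : (trinomialSq p 1).eval c = 0) : (trinomialSq p 1).derivative.eval c ≠ 0 := by
  intro h
  rw [trinomialSq_eval] at hc
  rw [trinomialSq_derivative_eval] at h
  obtain ⟨m, rfl⟩ : ∃ m, p = m + 2 := ⟨p - 2, by omega⟩
  have e1 : m + 2 - 1 = m + 1 := rfl
  rw [e1] at h
  have hsq : (m : k) * c ^ 2 = m + 2 := by
    push_cast at h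
    linear_combination c * h - (m + 2) * hc
  have hc0 : c ≠ 0 := by
    rintro rfl
    have : ((m + 2 : ℕ) : k) = 0 := by push_cast; linear_combination -hsq
    exact absurd this (Nat.cast_ne_zero.mpr (by omega))
  have h2 : ((m : k) + 2) * c ^ m = 2 := by
    apply mul_right_cancel₀ hc0
    push_cast at h
    linear_combination h
  have h3 : ((m : k) + 2) ^ (m + 2) = 4 * m ^ m := by
    calc ((m : k) + 2) ^ (m + 2) = (m + 2) ^ 2 * (m * c ^ 2) ^ m := by rw [hsq]; ring
      _ = ((m + 2) * c ^ m) ^ 2 * m ^ m := by rw [mul_pow, ← pow_mul]; ring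
      _ = 4 * m ^ m := by rw [h2]; ring
  have h4 : (m + 2) ^ (m + 2) = 4 * m ^ m := by exact_mod_cast h3
  have h5 : 4 * m ^ m < (m + 2) ^ (m + 2) := by
    rw [pow_add, mul_comm]
    have : m ^ m ≤ (m + 2) ^ m := Nat.pow_le_pow_left (by omega) _
    have : 0 < (m + 2) ^ m := by positivity
    have h6 : 4 < (m + 2) ^ 2 := by nlinarith
    nlinarith
  omega

theorem trinomialSq_splits_X {k : Type*} [Field k] [IsAlgClosed k] [CharZero k] {p : ℕ}
    (hp : 5 ≤ p) : ((trinomialSq p (1 - PowerSeries.X : PowerSeries k)).map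
      (algebraMap _ (FractionRing (PowerSeries k)))).Splits := by
  classical
  set f := trinomialSq p (1 - PowerSeries.X : PowerSeries k) with hf
  have hmon : f.Monic := trinomialSq_monic _ (by omega)
  have hbar : f.map PowerSeries.constantCoeff = trinomialSq p 1 := by
    rw [hf, trinomialSq_map]; simp
  have hlift : ∀ c : k, ∃ w : PowerSeries k, (trinomialSq p 1).eval c = 0 →
      f.eval w = 0 ∧ PowerSeries.constantCoeff w = c := by
    intro c
    by_cases hc : (trinomialSq p 1).eval c = 0
    · obtain ⟨w, hw⟩ := PowerSeries.exists_isRoot_of_simple hmon (a := c) (by rwa [hbar])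
        (by rw [hbar]; exact trinomialSq_derivative_eval_ne_zero hp c hc)
      exact ⟨w, fun _ ↦ hw⟩
    · exact ⟨0, fun h ↦ absurd h hc⟩
  choose w hw using hlift
  have hmon1 : (trinomialSq p (1 : k)).Monic := trinomialSq_monic _ (by omega)
  have hroots : ∀ c ∈ (trinomialSq p (1 : k)).roots.toFinset, (trinomialSq p 1).eval c = 0 := by
    intro c hc
    simpa [hmon1.ne_zero] using hc
  have hsep : (trinomialSq p (1 : k)).Separable := by
    rw [Polynomial.Separable, Polynomial.isCoprime_iff_aeval_ne_zero_of_isAlgClosed k k]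
    intro c
    simp only [Polynomial.coe_aeval_eq_eval]
    exact or_iff_not_imp_left.mpr fun h ↦
      trinomialSq_derivative_eval_ne_zero hp c (not_not.mp h)
  refine (Polynomial.splits_map_fractionRing hmon
    ((trinomialSq p (1 : k)).roots.toFinset.image w) ?_ ?_).1
  · rw [Finset.card_image_of_injOn, Multiset.toFinset_card_of_nodup (nodup_roots hsep),
      ← (IsAlgClosed.splits _).natDegree_eq_card_roots, trinomialSq_natDegree _ (by omega), hf,
      trinomialSq_natDegree _ (by omega)]
    intro c hc d hd h
    rw [← (hw c (hroots c hc)).2, ← (hw d (hroots d hd)).2, h]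
  · intro v hv
    obtain ⟨c, hc, rfl⟩ := Finset.mem_image.mp hv
    exact (hw c (hroots c hc)).1

/-- The automorphism `u ↦ -u` of `k⟦u⟧`. -/
noncomputable def PowerSeries.negEquiv (k : Type*) [Field k] : PowerSeries k ≃ₐ[k] PowerSeries k :=
  have h : (PowerSeries.rescale (-1 : k)).comp (PowerSeries.rescale (-1 : k)) = RingHom.id _ := by
    rw [← PowerSeries.rescale_mul]; simp
  AlgEquiv.ofRingEquiv (f := RingEquiv.ofRingHom _ _ h h) fun r ↦ by
    ext n
    simp only [PowerSeries.algebraMap_apply, RingEquiv.ofRingHom_apply, PowerSeries.coeff_rescale,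
      PowerSeries.coeff_C]
    split_ifs with h
    · simp [h]
    · simp

theorem PowerSeries.negEquiv_X (k : Type*) [Field k] :
    PowerSeries.negEquiv k PowerSeries.X = - PowerSeries.X :=
  PowerSeries.rescale_neg_one_X

theorem PowerSeries.constantCoeff_negEquiv {k : Type*} [Field k] (w : PowerSeries k) :
    PowerSeries.constantCoeff (PowerSeries.negEquiv k w) = PowerSeries.constantCoeff w := by
  rw [← PowerSeries.coeff_zero_eq_constantCoeff_apply,
    ← PowerSeries.coeff_zero_eq_constantCoeff_apply]
  change PowerSeries.coeff 0 (PowerSeries.rescale (-1) w) = _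
  simp [PowerSeries.coeff_rescale]

theorem exists_trinomialSq_roots {k : Type*} [Field k] [IsAlgClosed k] [CharZero k] {p : ℕ}
    (hp : 5 ≤ p) (hodd : Odd p) : ∃ S : Finset (PowerSeries k), S.card = p ∧
      (∀ w ∈ S, (trinomialSq p (-PowerSeries.X ^ 2 : PowerSeries k)).eval w = 0) ∧
      ∃ x ∈ S, ∃ y, x ≠ y ∧ PowerSeries.negEquiv k x = y ∧ PowerSeries.negEquiv k y = x ∧
        ∀ z ∈ S, z ≠ x → z ≠ y → PowerSeries.negEquiv k z = z := by
  classical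
  set f := trinomialSq p (-PowerSeries.X ^ 2 : PowerSeries k) with hf
  set σ := PowerSeries.negEquiv k with hσ
  obtain ⟨m, rfl⟩ : ∃ m, p = m + 2 := ⟨p - 2, by omega⟩
  have hm : Odd m := by simpa [Nat.odd_add] using hodd
  have hmk : (m : k) ≠ 0 := Nat.cast_ne_zero.mpr (by omega)
  have hmon : f.Monic := trinomialSq_monic _ (by omega)
  have hbar : f.map PowerSeries.constantCoeff = trinomialSq (m + 2) 0 := by
    rw [hf, trinomialSq_map]; simp
  have hσf : ∀ w, f.eval w = 0 → f.eval (σ w) = 0 := by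
    intro w hw
    rw [hf, trinomialSq_eval] at hw ⊢
    have := congrArg σ hw
    simpa [hσ, PowerSeries.negEquiv_X] using this
  have hζ : ∀ ζ : k, ζ ^ m = 1 → (trinomialSq (m + 2) (0 : k)).eval ζ = 0 ∧
      (trinomialSq (m + 2) (0 : k)).derivative.eval ζ ≠ 0 := by
    intro ζ h
    have hζ0 : ζ ≠ 0 := by
      rintro rfl
      rw [zero_pow (by omega)] at h; exact zero_ne_one h
    constructor
    · rw [trinomialSq_eval, pow_add, h]; ring
    · rw [trinomialSq_derivative_eval, show m + 2 - 1 = m + 1 from rfl, pow_succ, h]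
      push_cast
      rw [show ((m : k) + 2) * (1 * ζ) - 2 * ζ = m * ζ by ring]
      exact mul_ne_zero hmk hζ0
  have hlift : ∀ ζ : k, ∃ w : PowerSeries k, ζ ^ m = 1 →
      f.eval w = 0 ∧ PowerSeries.constantCoeff w = ζ := by
    intro c
    by_cases hc : c ^ m = 1
    · obtain ⟨w, hw⟩ := PowerSeries.exists_isRoot_of_simple hmon (a := c)
        (by rw [hbar]; exact (hζ c hc).1) (by rw [hbar]; exact (hζ c hc).2)
      exact ⟨w, fun _ ↦ hw⟩
    · exact ⟨0, fun h ↦ absurd h hc⟩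
  choose r hr using hlift
  have hσr : ∀ ζ, ζ ^ m = 1 → σ (r ζ) = r ζ := by
    intro ζ h
    refine PowerSeries.isRoot_unique_of_simple (f := f) (a := ζ) ?_ (hσf _ (hr ζ h).1) (hr ζ h).1
      ?_ (hr ζ h).2
    · rw [hbar]; exact (hζ ζ h).2
    · rw [hσ, PowerSeries.constantCoeff_negEquiv, (hr ζ h).2]
  -- the two ramified roots
  set g : (PowerSeries k)[X] := X ^ (m + 2) + (X ^ m - C (PowerSeries.X ^ m)) with hg
  have hgmon : g.Monic := by
    apply monic_X_pow_add
    refine (degree_sub_le _ _).trans_lt (max_lt ?_ ?_)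
    · rw [degree_X_pow]; exact_mod_cast (by omega : m < m + 2)
    · exact degree_C_le.trans_lt (by exact_mod_cast (by omega : 0 < m + 2))
  have hgeval : ∀ w, g.eval w = w ^ (m + 2) + (w ^ m - PowerSeries.X ^ m) := by
    intro w; simp [hg]
  obtain ⟨m', rfl⟩ : ∃ m', m = m' + 1 := ⟨m - 1, by omega⟩
  have hgbar : g.map PowerSeries.constantCoeff = X ^ (m' + 1 + 2) + X ^ (m' + 1) := by
    simp [hg]
  have hε : ∀ ε : k, ε ^ 2 = -1 → (g.map PowerSeries.constantCoeff).eval ε = 0 ∧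
      (g.map PowerSeries.constantCoeff).derivative.eval ε ≠ 0 := by
    intro ε h
    have h0 : ε ≠ 0 := by
      rintro rfl; simp at h
    rw [hgbar]
    constructor
    · simp only [eval_add, eval_pow, eval_X]
      linear_combination ε ^ (m' + 1) * h
    · simp only [derivative_add, derivative_X_pow, eval_add, eval_mul, eval_C, eval_pow, eval_X]
      rw [show ((m' + 1 + 2 : ℕ) : k) * ε ^ (m' + 1 + 2 - 1) + ((m' + 1 : ℕ) : k) * ε ^ (m' + 1 - 1)
        = -2 * ε ^ m' by
          rw [show m' + 1 + 2 - 1 = m' + 2 from rfl, show m' + 1 - 1 = m' from rfl]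
          push_cast
          linear_combination (m' + 3) * ε ^ m' * h]
      exact mul_ne_zero (by norm_num) (pow_ne_zero _ h0)
  obtain ⟨i, hi⟩ : ∃ i : k, i ^ 2 = -1 := IsAlgClosed.exists_pow_nat_eq _ (by norm_num)
  have hi' : (-i) ^ 2 = -1 := by rw [neg_sq, hi]
  have hi0 : i ≠ 0 := by rintro rfl; simp at hi
  obtain ⟨z, hz, hz0⟩ := PowerSeries.exists_isRoot_of_simple hgmon (hε i hi).1 (hε i hi).2
  have hX : (PowerSeries.X : PowerSeries k) ≠ 0 := PowerSeries.X_ne_zero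
  have hzz : z * z⁻¹ = 1 := PowerSeries.mul_inv_cancel _ (by rw [hz0]; exact hi0)
  set x := PowerSeries.X * z⁻¹ with hx
  have hxf : f.eval x = 0 := by
    rw [hgeval] at hz
    rw [hf, trinomialSq_eval, hx]
    have hz1 : (z⁻¹) ^ (m' + 1 + 2) * z ^ (m' + 1 + 2) = 1 := by
      rw [← mul_pow, mul_comm, hzz, one_pow]
    have hz2 : (z⁻¹) ^ (m' + 1 + 2) * z ^ (m' + 1) = z⁻¹ ^ 2 := by
      rw [pow_add, mul_right_comm, ← mul_pow, mul_comm z⁻¹, hzz, one_pow, one_mul]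
    rw [mul_pow, mul_pow]
    linear_combination (-PowerSeries.X ^ 2 * z⁻¹ ^ (m' + 1 + 2)) * hz + PowerSeries.X ^ 2 * hz1 +
      PowerSeries.X ^ 2 * hz2
  have hσσ : ∀ w, σ (σ w) = w := (PowerSeries.negEquiv k).right_inv
  have hxy : x ≠ σ x := by
    rw [hx, map_mul, hσ, PowerSeries.negEquiv_X, neg_mul, ← mul_neg]
    intro h
    have h := congrArg PowerSeries.constantCoeff (mul_left_cancel₀ hX h)
    rw [map_neg, PowerSeries.constantCoeff_negEquiv, PowerSeries.constantCoeff_inv, hz0] at h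
    exact inv_ne_zero hi0 (self_eq_neg.mp h)
  have hx0 : PowerSeries.constantCoeff x = 0 := by simp [hx]
  have hσx0 : PowerSeries.constantCoeff (σ x) = 0 := by
    rw [hσ, PowerSeries.constantCoeff_negEquiv, hx0]
  have hr0 : ∀ ζ, ζ ^ (m' + 1) = 1 → PowerSeries.constantCoeff (r ζ) ≠ 0 := by
    intro ζ h
    rw [(hr ζ h).2]
    rintro rfl
    simp at h
  have : NeZero ((m' + 1 : ℕ) : k) := ⟨hmk⟩
  obtain ⟨ξ, hξ⟩ := HasEnoughRootsOfUnity.exists_primitiveRoot k (m' + 1)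
  have hmem : ∀ ζ, ζ ∈ nthRootsFinset (m' + 1) (1 : k) ↔ ζ ^ (m' + 1) = 1 := fun ζ ↦
    mem_nthRootsFinset (by omega) _
  refine ⟨insert x (insert (σ x) ((nthRootsFinset (m' + 1) (1 : k)).image r)), ?_, ?_, x, by simp,
    σ x, hxy, rfl, hσσ x, ?_⟩
  · have h2 : σ x ∉ (nthRootsFinset (m' + 1) (1 : k)).image r := by
      rw [Finset.mem_image]
      rintro ⟨ζ, hζ, h⟩
      exact hr0 ζ ((hmem ζ).mp hζ) (by rw [h, hσx0])
    have h1 : x ∉ insert (σ x) ((nthRootsFinset (m' + 1) (1 : k)).image r) := by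
      rw [Finset.mem_insert, Finset.mem_image]
      rintro (h | ⟨ζ, hζ, h⟩)
      · exact hxy h
      · exact hr0 ζ ((hmem ζ).mp hζ) (by rw [h, hx0])
    rw [Finset.card_insert_of_notMem h1, Finset.card_insert_of_notMem h2, Finset.card_image_of_injOn,
      hξ.card_nthRootsFinset]
    intro c hc d hd h
    rw [← (hr c ((hmem c).mp hc)).2, ← (hr d ((hmem d).mp hd)).2, h]
  · intro w hw
    simp only [Finset.mem_insert, Finset.mem_image] at hw
    rcases hw with rfl | rfl | ⟨ζ, h, rfl⟩
    · exact hxf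
    · exact hσf _ hxf
    · exact (hr ζ ((hmem ζ).mp h)).1
  · intro w hw h1 h2
    simp only [Finset.mem_insert, Finset.mem_image, h1, h2, false_or] at hw
    obtain ⟨ζ, h, rfl⟩ := hw
    exact hσr ζ ((hmem ζ).mp h)

/-- A Galois extension of `k(t)` containing a given finite group properly in its Galois group, which
is unramified over `t = 0`. -/
theorem exists_isGalois_of_finite_group (k : Type) [Field k] [IsAlgClosed k] [CharZero k]
    (G : Type) [Group G] [Finite G] :
    ∃ (E : Type) (_ : Field E) (_ : Algebra k E) (_ : Algebra (RatFunc k) E)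
      (_ : IsScalarTower k (RatFunc k) E) (_ : FiniteDimensional (RatFunc k) E)
      (_ : IsGalois (RatFunc k) E) (ρ : G →* (E ≃ₐ[RatFunc k] E))
      (ι : E →ₐ[k] FractionRing (PowerSeries k)),
      Function.Injective ρ ∧ ¬ Function.Surjective ρ ∧
      ι (algebraMap _ _ (RatFunc.X : RatFunc k)) = algebraMap _ _ (PowerSeries.X : PowerSeries k) := by
  obtain ⟨p, hp, hpp⟩ := Nat.exists_infinite_primes (max (Nat.card G + 1) 5)
  have hp5 : 5 ≤ p := (le_max_right _ _).trans hp
  have hpG : Nat.card G < p := (le_max_left _ _).trans hp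
  have hodd : Odd p := hpp.odd_of_ne_two (by omega)
  let L := FractionRing (PowerSeries k)
  set f := trinomialSq p (1 - RatFunc.X : RatFunc k) with hf
  have hirr : Irreducible f := trinomialSq_irreducible (by omega)
  have hsep : f.Separable := hirr.separable
  have hdeg : f.natDegree = p := trinomialSq_natDegree _ (by omega)
  have htX : Transcendental k (PowerSeries.X : PowerSeries k) := by
    have := PowerSeries.transcendental_coe (X : k[X]) (by simp)
    simpa using this
  have htY : Transcendental k (1 + PowerSeries.X ^ 2 : PowerSeries k) := by
    have := PowerSeries.transcendental_coe (1 + X ^ 2 : k[X])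
      (by rw [← C_1, natDegree_C_add, natDegree_X_pow]; norm_num)
    simpa using this
  -- the Galois group is the full symmetric group
  have hGal : ∃ α : Type, Nat.card α = p ∧ Nonempty (f.Gal ≃* Equiv.Perm α) := by
    let j := RatFunc.toFracPowerSeries _ htY
    let : Algebra (RatFunc k) L := j.toRingHom.toAlgebra
    obtain ⟨S, hS, hroot, x, hx, y, hxy, hσx, hσy, hσ⟩ := exists_trinomialSq_roots (k := k) hp5 hodd
    have hjX : algebraMap (RatFunc k) L RatFunc.X =
        algebraMap _ _ (1 + PowerSeries.X ^ 2 : PowerSeries k) :=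
      RatFunc.toFracPowerSeries_X _ htY
    have hmap : f.map (algebraMap (RatFunc k) L) =
        (trinomialSq p (-PowerSeries.X ^ 2 : PowerSeries k)).map (algebraMap _ L) := by
      rw [hf, trinomialSq_map, trinomialSq_map, map_sub, hjX, map_one]
      congr 1
      rw [map_add, map_one, map_neg]
      ring
    have hS' := Polynomial.splits_map_fractionRing
      (trinomialSq_monic (-PowerSeries.X ^ 2 : PowerSeries k) (by omega : 3 ≤ p)) S
      (by rw [hS, trinomialSq_natDegree _ (by omega)]) hroot
    have hfact : Fact ((f.map (algebraMap (RatFunc k) L)).Splits) := ⟨by rw [hmap]; exact hS'.1⟩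
    let σ : L ≃+* L := IsFractionRing.ringEquivOfRingEquiv (PowerSeries.negEquiv k).toRingEquiv
    have hσW : ∀ w : PowerSeries k, σ (algebraMap _ L w) = algebraMap _ L (PowerSeries.negEquiv k w) :=
      fun w ↦ IsFractionRing.ringEquivOfRingEquiv_algebraMap _ _
    have hσj : ∀ r, σ (algebraMap (RatFunc k) L r) = algebraMap (RatFunc k) L r := by
      have : (σ : L →+* L).comp (algebraMap (RatFunc k) L) = algebraMap (RatFunc k) L := by
        apply IsLocalization.ringHom_ext (nonZeroDivisors k[X])
        apply Polynomial.ringHom_ext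
        · intro a
          have : algebraMap (RatFunc k) L (algebraMap k[X] (RatFunc k) (C a)) =
              algebraMap (PowerSeries k) L (algebraMap k _ a) := by
            rw [RatFunc.algebraMap_C, ← RatFunc.algebraMap_eq_C]
            exact j.commutes a
          simp only [RingHom.comp_apply, this]
          exact (hσW _).trans (by rw [AlgEquiv.commutes])
        · simp only [RingHom.comp_apply, RatFunc.algebraMap_X, hjX]
          refine (hσW _).trans ?_
          rw [map_add, map_pow, map_one, PowerSeries.negEquiv_X, neg_sq]
      exact fun r ↦ congrArg (fun φ : RatFunc k →+* L ↦ φ r) this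
    have hinj := IsFractionRing.injective (PowerSeries k) L
    have hbij := Polynomial.Gal.galActionHom_bijective_of_swap hirr (by rwa [hdeg])
      (AlgEquiv.ofRingEquiv (f := σ) hσj) (algebraMap _ L x) (algebraMap _ L y)
      (by
        rw [Polynomial.mem_rootSet, Polynomial.aeval_def, ← Polynomial.eval_map, hmap,
          Polynomial.eval_map_apply, hroot x hx, map_zero]
        exact ⟨hirr.ne_zero, rfl⟩)
      (hinj.ne hxy) ((hσW x).trans (by rw [hσx])) ((hσW y).trans (by rw [hσy]))
      (by
        intro z hz hzx hzy
        rw [Polynomial.mem_rootSet, Polynomial.aeval_def, ← Polynomial.eval_map, hmap] at hz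
        obtain ⟨w, hw, rfl⟩ := hS'.2 z hz.2
        refine (hσW w).trans ?_
        rw [hσ w hw (fun h ↦ hzx (by rw [h])) (fun h ↦ hzy (by rw [h]))])
    refine ⟨f.rootSet L, ?_, ⟨MulEquiv.ofBijective _ hbij⟩⟩
    rw [Nat.card_eq_fintype_card, Polynomial.card_rootSet_eq_natDegree hsep hfact.1, hdeg]
  have : IsGalois (RatFunc k) f.SplittingField := IsGalois.of_separable_splitting_field hsep
  obtain ⟨α, hα, ⟨e⟩⟩ := hGal
  have : Finite α := Nat.finite_of_card_ne_zero (by omega)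
  have hlt : Nat.card G < Nat.card f.Gal := by
    refine hpG.trans_le (Nat.le_of_dvd Nat.card_pos ?_)
    rw [← hdeg]
    exact Gal.prime_degree_dvd_card hirr (by rwa [hdeg])
  obtain ⟨ρ, hρ, hρ'⟩ := Group.exists_injective_not_surjective_hom (G := G) e (by omega) hlt
  let j := RatFunc.toFracPowerSeries _ htX
  let : Algebra (RatFunc k) L := j.toRingHom.toAlgebra
  have hjX : algebraMap (RatFunc k) L RatFunc.X = algebraMap _ _ PowerSeries.X :=
    RatFunc.toFracPowerSeries_X _ htX
  have hspl : (f.map (algebraMap (RatFunc k) L)).Splits := by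
    have := trinomialSq_splits_X (k := k) hp5
    rw [trinomialSq_map] at this
    rw [hf, trinomialSq_map, map_sub, hjX, map_one]
    rwa [map_sub, map_one] at this
  let ι := Polynomial.SplittingField.lift f hspl
  have : IsScalarTower k (RatFunc k) L := IsScalarTower.of_algebraMap_eq fun r ↦ (j.commutes r).symm
  refine ⟨f.SplittingField, inferInstance, inferInstance, inferInstance, inferInstance,
    inferInstance, inferInstance, ρ, ι.restrictScalars k, hρ, hρ', ?_⟩
  exact (ι.commutes _).trans hjX

/-- The integral closure of the subring `k[a]` in `A`. -/
noncomputable def intOver (k : Type*) {A : Type*} [CommRing k] [CommRing A] [Algebra k A] (a : A) :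
    Subring A :=
  letI : Algebra k[X] A := (aeval a : k[X] →ₐ[k] A).toRingHom.toAlgebra
  (integralClosure k[X] A).toSubring

section
variable {k A B : Type*} [CommRing k] [CommRing A] [CommRing B] [Algebra k A] [Algebra k B]

theorem mem_intOver_iff {a y : A} :
    y ∈ intOver k a ↔ (aeval a : k[X] →ₐ[k] A).toRingHom.IsIntegralElem y := Iff.rfl

theorem aeval_mem_intOver (a : A) (P : k[X]) : aeval a P ∈ intOver k a :=
  RingHom.isIntegralElem_map (aeval a : k[X] →ₐ[k] A).toRingHom

theorem self_mem_intOver (a : A) : a ∈ intOver k a := by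
  simpa using aeval_mem_intOver (k := k) a X

theorem algebraMap_mem_intOver (a : A) (c : k) : algebraMap k A c ∈ intOver k a := by
  simpa using aeval_mem_intOver (k := k) a (C c)

theorem mem_intOver_of_pow_mem {a y : A} {n : ℕ} (hn : 0 < n) (h : y ^ n ∈ intOver k a) :
    y ∈ intOver k a := by
  let := (aeval a : k[X] →ₐ[k] A).toRingHom.toAlgebra
  exact IsIntegral.of_pow (R := k[X]) hn h

theorem aeval_toRingHom_comp (φ : A →ₐ[k] B) (a : A) :
    (φ : A →+* B).comp (aeval a : k[X] →ₐ[k] A).toRingHom =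
      (aeval (φ a) : k[X] →ₐ[k] B).toRingHom := by
  ext x
  · simp
  · simp

theorem map_mem_intOver (φ : A →ₐ[k] B) {a y : A} (h : y ∈ intOver k a) :
    φ y ∈ intOver k (φ a) := by
  obtain ⟨p, hp, h⟩ := mem_intOver_iff.mp h
  refine ⟨p, hp, ?_⟩
  have := congrArg (φ : A →+* B) h
  rw [map_zero, Polynomial.hom_eval₂] at this
  rw [← this]
  exact congrArg (fun f ↦ eval₂ f (φ y) p) (aeval_toRingHom_comp φ a).symm

theorem map_mem_intOver_iff {φ : A →ₐ[k] B} (hφ : Function.Injective φ) {a y : A} :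
    φ y ∈ intOver k (φ a) ↔ y ∈ intOver k a := by
  refine ⟨?_, map_mem_intOver φ⟩
  intro h
  obtain ⟨p, hp, h⟩ := mem_intOver_iff.mp h
  refine ⟨p, hp, hφ ?_⟩
  rw [map_zero, ← h]
  refine (Polynomial.hom_eval₂ p _ (φ : A →+* B) y).trans ?_
  exact congrArg (fun f ↦ eval₂ f (φ y) p) (aeval_toRingHom_comp φ a)

theorem intOver_le_of_mem {a b : A} (hb : b ∈ intOver k a) : intOver k b ≤ intOver k a := by
  intro y h
  obtain ⟨p, hp, h⟩ := mem_intOver_iff.mp h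
  have hmem : ∀ P : k[X], aeval b P ∈ intOver k a := by
    intro P
    rw [aeval_eq_sum_range]
    refine sum_mem fun i _ ↦ ?_
    rw [Algebra.smul_def]
    exact mul_mem (algebraMap_mem_intOver a _) (pow_mem hb _)
  let := (aeval a : k[X] →ₐ[k] A).toRingHom.toAlgebra
  let S : Subalgebra k[X] A := integralClosure k[X] A
  let f : k[X] →+* S := (aeval b : k[X] →ₐ[k] A).toRingHom.codRestrict S hmem
  have hf : (algebraMap S A).comp f = (aeval b : k[X] →ₐ[k] A).toRingHom := RingHom.ext fun _ ↦ rfl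
  have hy : IsIntegral S y := by
    refine ⟨p.map f, hp.map f, ?_⟩
    rw [Polynomial.eval₂_map, hf]
    exact h
  exact isIntegral_trans y hy

theorem exists_of_mem_intOver_of_lift {D : Type*} [CommRing D] [IsDomain D]
    [IsIntegrallyClosed D] {L : Type*} [Field L] [Algebra D L] [IsFractionRing D L] [Algebra k D]
    [Algebra k L] [IsScalarTower k D L] {d : D} {y : L} (h : y ∈ intOver k (algebraMap D L d)) :
    ∃ w : D, algebraMap D L w = y := by
  rw [← IsIntegrallyClosed.isIntegral_iff (R := D)]
  obtain ⟨p, hp, h⟩ := mem_intOver_iff.mp h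
  refine ⟨p.map (aeval d : k[X] →ₐ[k] D).toRingHom, hp.map _, ?_⟩
  rw [Polynomial.eval₂_map, ← h]
  exact congrArg (fun f ↦ eval₂ f y p) (aeval_toRingHom_comp (IsScalarTower.toAlgHom k D L) d)

theorem valuation_le_one_of_mem_intOver {Γ : Type*} [LinearOrderedCommGroupWithZero Γ]
    (v : Valuation A Γ) {a y : A} (ha : v a ≤ 1) (hk : ∀ c, v (algebraMap k A c) ≤ 1)
    (h : y ∈ intOver k a) : v y ≤ 1 := by
  have hmem : ∀ P : k[X], aeval a P ∈ v.integer := by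
    intro P
    rw [aeval_eq_sum_range]
    refine sum_mem fun i _ ↦ ?_
    rw [Algebra.smul_def]
    exact mul_mem (hk _) (pow_mem (show a ∈ v.integer from ha) _)
  obtain ⟨p, hp, h⟩ := mem_intOver_iff.mp h
  refine (Valuation.integer.integers v).mem_of_integral
    ⟨p.map ((aeval a : k[X] →ₐ[k] A).toRingHom.codRestrict v.integer hmem), hp.map _, ?_⟩
  rw [Polynomial.eval₂_map, ← h]
  rfl

theorem leadingCoeff_mul_mem_intOver [Nontrivial A] {a y : A} {p : A[X]}
    (hp : ∀ i, ∃ P : k[X], aeval a P = p.coeff i) (hy : p.eval y = 0) :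
    p.leadingCoeff * y ∈ intOver k a := by
  obtain ⟨q, rfl, hq⟩ := exists_degree_eq_of_mem_lifts (f := (aeval a : k[X] →ₐ[k] A).toRingHom) (p := p)
    ((lifts_iff_coeff_lifts _).mpr fun i ↦ hp i)
  have := RingHom.isIntegralElem_leadingCoeff_mul (aeval a : k[X] →ₐ[k] A).toRingHom q y
    (by rw [← eval_map]; exact hy)
  rw [mem_intOver_iff]
  convert this using 2
  rw [leadingCoeff, leadingCoeff, coeff_map, natDegree_eq_of_degree_eq hq]
end

section
variable {k : Type*} [Field k]

theorem natDegree_le_of_mem_intOver_inv {P : k[X]} (hP : P ≠ 0) {m e : ℕ}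
    (h : (algebraMap k[X] (RatFunc k) P) ^ m * (RatFunc.X⁻¹) ^ e ∈
      intOver k ((RatFunc.X : RatFunc k)⁻¹)) : m * P.natDegree ≤ e := by
  classical
  have hX : RatFunc.inftyValuation k (RatFunc.X⁻¹) = WithZero.exp (-1 : ℤ) := by
    rw [map_inv₀, RatFunc.inftyValuation.X, WithZero.exp_neg]
  have := valuation_le_one_of_mem_intOver (RatFunc.inftyValuation k) ?_ ?_ h
  · rw [map_mul, map_pow, map_pow, hX, RatFunc.inftyValuation_apply,
      RatFunc.inftyValuation.polynomial k hP, ← WithZero.exp_nsmul,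
      ← WithZero.exp_nsmul, ← WithZero.exp_add, ← WithZero.exp_zero, WithZero.exp_le_exp] at this
    simp only [nsmul_eq_mul] at this
    have h2 : (m : ℤ) * P.natDegree ≤ e := by linarith
    exact_mod_cast h2
  · rw [hX, ← WithZero.exp_zero, WithZero.exp_le_exp]; norm_num
  · intro c
    by_cases hc : c = 0
    · simp [hc]
    · rw [RatFunc.algebraMap_eq_C, RatFunc.inftyValuation.C k hc]

variable {E : Type*} [Field E] [Algebra k E]

theorem exists_coe_of_mem_intOver {ι : E →ₐ[k] FractionRing (PowerSeries k)} {t : E}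
    (hι : ι t = algebraMap _ _ (PowerSeries.X : PowerSeries k)) {y : E} (h : y ∈ intOver k t) :
    ∃ w : PowerSeries k, algebraMap _ _ w = ι y :=
  exists_of_mem_intOver_of_lift (D := PowerSeries k) (k := k) (by
    rw [← hι]; exact map_mem_intOver ι h)

theorem exists_coe_of_pow_mul_mem_intOver {ι : E →ₐ[k] FractionRing (PowerSeries k)} {t : E}
    (hι : ι t = algebraMap _ _ (PowerSeries.X : PowerSeries k)) {y : E} {m i : ℕ} (him : i < m)
    (h : y ^ m * t ^ i ∈ intOver k t) : ∃ w : PowerSeries k, algebraMap _ _ w = ι y := by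
  obtain ⟨r, hr⟩ := exists_coe_of_mem_intOver hι h
  have h1 : y * t ∈ intOver k t := by
    apply mem_intOver_of_pow_mem (by omega : 0 < m)
    have : (y * t) ^ m = y ^ m * t ^ i * t ^ (m - i) := by
      rw [mul_assoc, ← pow_add, mul_pow]; congr 2; omega
    rw [this]
    exact mul_mem h (pow_mem (self_mem_intOver _) _)
  obtain ⟨w, hw⟩ := exists_coe_of_mem_intOver hι h1
  have hinj := IsFractionRing.injective (PowerSeries k) (FractionRing (PowerSeries k))
  have h2 : w ^ m = r * PowerSeries.X ^ (m - i) := by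
    apply hinj
    rw [map_pow, map_mul, map_pow, hw, hr, ← hι, ← map_pow, ← map_pow, ← map_mul]
    congr 1
    rw [mul_assoc, ← pow_add, mul_pow]; congr 2; omega
  have h3 : PowerSeries.X ∣ w := by
    apply (PowerSeries.X_prime (R := k)).dvd_of_dvd_pow (n := m)
    rw [h2]
    exact Dvd.dvd.mul_left (dvd_pow_self _ (by omega)) _
  obtain ⟨v, rfl⟩ := h3
  refine ⟨v, ?_⟩
  rw [map_mul, map_mul, hι, mul_comm] at hw
  refine mul_right_cancel₀ ?_ hw
  rw [← map_zero (algebraMap (PowerSeries k) (FractionRing (PowerSeries k)))]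
  exact hinj.ne PowerSeries.X_ne_zero

variable [Algebra (RatFunc k) E] [IsScalarTower k (RatFunc k) E]

theorem algebraMap_coe_eq {ι : E →ₐ[k] FractionRing (PowerSeries k)}
    (hι : ι (algebraMap (RatFunc k) E RatFunc.X) = algebraMap _ _ (PowerSeries.X : PowerSeries k))
    (P : k[X]) : algebraMap _ _ (P : PowerSeries k) =
      ι (algebraMap (RatFunc k) E (algebraMap k[X] (RatFunc k) P)) := by
  have : (algebraMap (PowerSeries k) (FractionRing (PowerSeries k))).comp
      Polynomial.coeToPowerSeries.ringHom =
      (ι : E →+* _).comp ((algebraMap (RatFunc k) E).comp (algebraMap k[X] (RatFunc k))) := by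
    apply Polynomial.ringHom_ext
    · intro a
      simp only [RingHom.comp_apply, RatFunc.algebraMap_C, coeToPowerSeries.ringHom_apply,
        Polynomial.coe_C]
      rw [← RatFunc.algebraMap_eq_C, ← IsScalarTower.algebraMap_apply]
      exact (ι.commutes a).symm
    · simp only [RingHom.comp_apply, RatFunc.algebraMap_X, coeToPowerSeries.ringHom_apply,
        Polynomial.coe_X]
      exact hι.symm
  exact congrArg (fun f : k[X] →+* FractionRing (PowerSeries k) ↦ f P) this

theorem eq_algebraMap_of_mem_intOver [FiniteDimensional (RatFunc k) E] [IsGalois (RatFunc k) E]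
    (ι : E →ₐ[k] FractionRing (PowerSeries k)) {t : E} (ht : algebraMap (RatFunc k) E RatFunc.X = t)
    (hι : ι t = algebraMap _ _ (PowerSeries.X : PowerSeries k)) {y : E} {m i d : ℕ} (him : i < m)
    (hm : Module.finrank (RatFunc k) E * d < m) (h1 : y ^ m * t ^ i ∈ intOver k t)
    (h2 : y ^ m * t⁻¹ ^ d ∈ intOver k t⁻¹) : ∃ c : k, algebraMap k E c = y := by
  classical
  have hσt : ∀ σ : E ≃ₐ[RatFunc k] E, σ t = t := fun σ ↦ by rw [← ht, AlgEquiv.commutes]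
  have hσ1 : ∀ (σ : E ≃ₐ[RatFunc k] E) {x : E}, x ∈ intOver k t → σ x ∈ intOver k t := fun σ x h ↦ by
    have := map_mem_intOver (σ.restrictScalars k).toAlgHom h
    simpa [hσt] using this
  have hσ2 : ∀ (σ : E ≃ₐ[RatFunc k] E) {x : E}, x ∈ intOver k t⁻¹ → σ x ∈ intOver k t⁻¹ :=
    fun σ x h ↦ by
    have := map_mem_intOver (σ.restrictScalars k).toAlgHom h
    simpa [hσt] using this
  set n := Module.finrank (RatFunc k) E with hn
  have hcard : Fintype.card (E ≃ₐ[RatFunc k] E) = n := by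
    rw [← Nat.card_eq_fintype_card, IsGalois.card_aut_eq_finrank]
  have hw : ∀ σ : E ≃ₐ[RatFunc k] E, ∃ w : PowerSeries k, algebraMap _ _ w = ι (σ y) := fun σ ↦ by
    refine exists_coe_of_pow_mul_mem_intOver hι him ?_
    have := hσ1 σ h1
    rwa [map_mul, map_pow, map_pow, hσt] at this
  choose w hw using hw
  set c := PowerSeries.constantCoeff (w 1) with hc
  set N := Algebra.norm (RatFunc k) (y - algebraMap k E c) with hN
  have hNprod : algebraMap (RatFunc k) E N = ∏ σ : E ≃ₐ[RatFunc k] E, σ (y - algebraMap k E c) :=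
    Algebra.norm_eq_prod_automorphisms _ _
  let j : RatFunc k →ₐ[k] E := IsScalarTower.toAlgHom k (RatFunc k) E
  have hj : Function.Injective j := (algebraMap (RatFunc k) E).injective
  have hjX : j RatFunc.X = t := ht
  have hjXi : j RatFunc.X⁻¹ = t⁻¹ := by rw [map_inv₀, hjX]
  -- `N * t ^ n` is a polynomial
  have hP : ∃ P : k[X], algebraMap k[X] (RatFunc k) P = N * RatFunc.X ^ n := by
    refine exists_of_mem_intOver_of_lift (D := k[X]) (k := k) (d := X) ?_
    rw [RatFunc.algebraMap_X, ← map_mem_intOver_iff hj, map_mul, map_pow, hjX]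
    change algebraMap (RatFunc k) E N * _ ∈ _
    rw [hNprod, ← hcard, ← Finset.card_univ, ← Finset.prod_const, ← Finset.prod_mul_distrib]
    refine prod_mem fun σ _ ↦ ?_
    suffices h : (y - algebraMap k E c) * t ∈ intOver k t by
      have := hσ1 σ h
      rwa [map_mul, hσt] at this
    rw [sub_mul]
    refine sub_mem ?_ (mul_mem (algebraMap_mem_intOver _ _) (self_mem_intOver _))
    apply mem_intOver_of_pow_mem (by omega : 0 < m)
    have : (y * t) ^ m = y ^ m * t ^ i * t ^ (m - i) := by
      rw [mul_assoc, ← pow_add, mul_pow]; congr 2; omega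
    rw [this]
    exact mul_mem h1 (pow_mem (self_mem_intOver _) _)
  obtain ⟨P, hP⟩ := hP
  have hinj := IsFractionRing.injective (PowerSeries k) (FractionRing (PowerSeries k))
  have hPW : (P : PowerSeries k) = PowerSeries.X ^ n * ∏ σ, (w σ - PowerSeries.C c) := by
    apply hinj
    rw [algebraMap_coe_eq (by rw [ht]; exact hι) P, hP, map_mul, map_mul, hNprod, map_pow, map_pow, ht,
      hι, map_mul, map_pow, mul_comm, map_prod, map_prod]
    congr 1
    refine Finset.prod_congr rfl fun σ _ ↦ ?_
    rw [map_sub, map_sub, map_sub, hw]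
    congr 1
    rw [IsScalarTower.algebraMap_apply k (RatFunc k) E, AlgEquiv.commutes,
      ← IsScalarTower.algebraMap_apply k (RatFunc k) E, ι.commutes]
    rfl
  have hdvd : (X : k[X]) ^ (n + 1) ∣ P := by
    rw [Polynomial.X_pow_dvd_iff]
    intro l hl
    rw [← Polynomial.coeff_coe]
    refine (PowerSeries.X_pow_dvd_iff (n := n + 1)).mp ?_ l hl
    rw [hPW, pow_succ]
    refine mul_dvd_mul_left _ ((PowerSeries.X_dvd_iff.mpr ?_).trans
      (Finset.dvd_prod_of_mem _ (Finset.mem_univ 1)))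
    simp [hc]
  obtain ⟨Q, rfl⟩ := hdvd
  have hNQ : N = algebraMap k[X] (RatFunc k) (X * Q) := by
    have h0 : (RatFunc.X : RatFunc k) ^ n ≠ 0 := pow_ne_zero _ RatFunc.X_ne_zero
    apply mul_right_cancel₀ h0
    rw [← hP, ← RatFunc.algebraMap_X, ← map_pow, ← map_mul]
    congr 1
    ring
  have hpow : (y - algebraMap k E c) ^ m * t⁻¹ ^ d ∈ intOver k t⁻¹ := by
    rw [sub_eq_add_neg, add_pow, Finset.sum_mul]
    refine sum_mem fun l hl ↦ ?_
    have hl : l ≤ m := Nat.lt_succ_iff.mp (Finset.mem_range.mp hl)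
    have h3 : y ^ l * t⁻¹ ^ d ∈ intOver k t⁻¹ := by
      apply mem_intOver_of_pow_mem (by omega : 0 < m)
      have : (y ^ l * t⁻¹ ^ d) ^ m = (y ^ m * t⁻¹ ^ d) ^ l * (t⁻¹) ^ (d * (m - l)) := by
        rw [mul_pow, mul_pow, ← pow_mul, ← pow_mul, ← pow_mul, ← pow_mul, mul_assoc, ← pow_add,
          mul_comm l m]
        congr 2
        obtain ⟨e, rfl⟩ := Nat.exists_eq_add_of_le hl
        rw [Nat.add_sub_cancel_left]; ring
      rw [this]
      exact mul_mem (pow_mem h2 _) (pow_mem (self_mem_intOver _) _)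
    rw [show y ^ l * (-algebraMap k E c) ^ (m - l) * (m.choose l : E) * t⁻¹ ^ d =
      (y ^ l * t⁻¹ ^ d) * (-algebraMap k E c) ^ (m - l) * (m.choose l : E) by ring]
    exact mul_mem (mul_mem h3 (pow_mem (neg_mem (algebraMap_mem_intOver _ _)) _)) (natCast_mem _ _)
  have hdeg : N ^ m * RatFunc.X⁻¹ ^ (n * d) ∈ intOver k (RatFunc.X : RatFunc k)⁻¹ := by
    rw [← map_mem_intOver_iff hj, map_mul, map_pow, map_pow, hjXi]
    change algebraMap (RatFunc k) E N ^ m * _ ∈ _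
    rw [hNprod, mul_comm n d, pow_mul, ← hcard, ← Finset.card_univ, ← Finset.prod_const,
      ← Finset.prod_pow, ← Finset.prod_mul_distrib]
    refine prod_mem fun σ _ ↦ ?_
    have := hσ2 σ hpow
    rwa [map_mul, map_pow, map_pow, map_inv₀, hσt] at this
  have hQ : Q = 0 := by
    by_contra hQ
    rw [hNQ] at hdeg
    have := natDegree_le_of_mem_intOver_inv (mul_ne_zero X_ne_zero hQ) hdeg
    rw [natDegree_X_mul hQ] at this
    nlinarith
  rw [hNQ, hQ, mul_zero, map_zero, map_zero] at hNprod
  obtain ⟨σ, -, hσ⟩ := Finset.prod_eq_zero_iff.mp hNprod.symm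
  refine ⟨c, ?_⟩
  rw [map_eq_zero_iff σ σ.injective, sub_eq_zero] at hσ
  exact hσ.symm
end

theorem Submodule.mem_of_sum_eigenvectors_mem {k V ι : Type*} [Field k] [AddCommGroup V]
    [Module k V] (S : Submodule k V) (τ : V →ₗ[k] V) (hτ : ∀ v ∈ S, τ v ∈ S) (u : ι → k)
    (s : Finset ι) (hu : Set.InjOn u s) (x : ι → V) (hx : ∀ i ∈ s, τ (x i) = u i • x i)
    (h : ∑ i ∈ s, x i ∈ S) : ∀ i ∈ s, x i ∈ S := by
  classical
  induction s using Finset.induction_on generalizing x with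
  | empty => simp
  | insert a s ha ih =>
    have h1 : ∑ i ∈ s, (u i - u a) • x i ∈ S := by
      have h2 : ∑ i ∈ s, (u i - u a) • x i =
          τ (∑ i ∈ insert a s, x i) - u a • ∑ i ∈ insert a s, x i := by
        rw [map_sum, Finset.smul_sum, ← Finset.sum_sub_distrib, Finset.sum_insert ha,
          hx a (by simp), sub_self, zero_add]
        refine Finset.sum_congr rfl fun i hi ↦ ?_
        rw [hx i (by simp [hi]), sub_smul]
      rw [h2]
      exact sub_mem (hτ _ h) (S.smul_mem _ h)
    have h3 := ih (hu.mono (by simp)) (fun i ↦ (u i - u a) • x i)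
      (fun i hi ↦ by rw [map_smul, hx i (by simp [hi]), smul_comm]) h1
    have h4 : ∀ i ∈ s, x i ∈ S := fun i hi ↦ by
      have hne : u i - u a ≠ 0 := fun h0 ↦ by
        have := hu (by simp [hi]) (by simp) (sub_eq_zero.mp h0)
        exact ha (this ▸ hi)
      exact (S.smul_mem_iff hne).mp (h3 i hi)
    intro i hi
    rw [Finset.sum_insert ha] at h
    rcases Finset.mem_insert.mp hi with rfl | hi
    · exact (S.add_mem_iff_left (sum_mem h4)).mp h
    · exact h4 i hi

section
variable {k : Type*} [Field k] {E K : Type*} [Field E] [Algebra k E] [Field K] [Algebra k K]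

theorem intOver_algebraMap_mul_le (c : k) (s : K) :
    intOver k (algebraMap k K c * s) ≤ intOver k s :=
  intOver_le_of_mem (mul_mem (algebraMap_mem_intOver _ _) (self_mem_intOver _))

theorem mem_intOver_of_sum_mem {s : K} (τ : K →ₐ[k] K) {c : k} (hs : τ s = algebraMap k K c * s)
    {ι : Type*} (u : ι → k) (I : Finset ι) (hu : Set.InjOn u I) (x : ι → K)
    (hx : ∀ i ∈ I, τ (x i) = u i • x i) (h : ∑ i ∈ I, x i ∈ intOver k s) :
    ∀ i ∈ I, x i ∈ intOver k s :=
  Submodule.mem_of_sum_eigenvectors_mem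
    { (intOver k s).toAddSubgroup.toAddSubmonoid with
      smul_mem' := fun c y hy ↦ by
        rw [Algebra.smul_def]
        exact mul_mem (algebraMap_mem_intOver s c) hy } τ.toLinearMap
    (fun v hv ↦ intOver_algebraMap_mul_le c s (hs ▸ map_mem_intOver τ hv)) u I hu x hx h

variable [Algebra E K] [IsScalarTower k E K]

/-- If `f` satisfies a nonzero polynomial equation over `k[s]` whose coefficients have degree at
most `n`, then a multiple of `f` by a nonzero element of `k[s]` is integral over `k[s]`, with poles
of order at most `n` over `s = ∞`. -/
theorem exists_mul_mem_intOver {s f : K} (hs : Transcendental k s) {n : ℕ} {P : k[X][X]}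
    (hP : P ≠ 0) (hn : ∀ i, (P.coeff i).natDegree ≤ n)
    (h : (P.map (aeval s : k[X] →ₐ[k] K).toRingHom).eval f = 0) :
    ∃ q : k[X], q ≠ 0 ∧ aeval s q * f ∈ intOver k s ∧
      aeval s q * f * s⁻¹ ^ n ∈ intOver k s⁻¹ := by
  have hs0 : s ≠ 0 := by
    rintro rfl
    exact hs isAlgebraic_zero
  have hinj : Function.Injective (aeval s : k[X] →ₐ[k] K).toRingHom :=
    transcendental_iff_injective.mp hs
  have hlc : (P.map (aeval s : k[X] →ₐ[k] K).toRingHom).leadingCoeff = aeval s P.leadingCoeff :=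
    leadingCoeff_map_of_injective hinj P
  refine ⟨P.leadingCoeff, leadingCoeff_ne_zero.mpr hP, ?_, ?_⟩
  · rw [← hlc]
    refine leadingCoeff_mul_mem_intOver (fun i ↦ ⟨P.coeff i, ?_⟩) h
    rw [coeff_map]; rfl
  · have := leadingCoeff_mul_mem_intOver (k := k) (a := s⁻¹) (y := f)
      (p := C (s⁻¹ ^ n) * P.map (aeval s : k[X] →ₐ[k] K).toRingHom) (fun i ↦
        ⟨(P.coeff i).reflect n, ?_⟩) (by rw [eval_mul, h, mul_zero])
    · rw [leadingCoeff_mul, leadingCoeff_C, hlc] at this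
      convert this using 1; ring
    · rw [coeff_C_mul, coeff_map]
      let := invertibleOfNonzero hs0
      have h1 := eval₂_reflect_mul_pow (algebraMap k K) s n (P.coeff i) (hn i)
      rw [invOf_eq_inv] at h1
      rw [inv_pow, mul_comm, ← div_eq_mul_inv, eq_div_iff (pow_ne_zero _ hs0)]
      exact h1

theorem mem_intOver_of_mul_pow_mem {s : K} {t : E} {m : ℕ} (hm : 0 < m)
    (hst : s ^ m = algebraMap E K t) {c : E} {i : ℕ} (h : algebraMap E K c * s ^ i ∈ intOver k s) :
    c ^ m * t ^ i ∈ intOver k t := by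
  rw [← map_mem_intOver_iff (φ := IsScalarTower.toAlgHom k E K) (algebraMap E K).injective]
  simp only [IsScalarTower.coe_toAlgHom', map_mul, map_pow, ← hst]
  have hs : s ∈ intOver k (s ^ m) := mem_intOver_of_pow_mem hm (self_mem_intOver _)
  refine intOver_le_of_mem hs ?_
  convert pow_mem h m using 1
  ring

theorem exists_aeval_eq_of_mem_intOver [Algebra (RatFunc k) E] [IsScalarTower k (RatFunc k) E]
    [FiniteDimensional (RatFunc k) E] [IsGalois (RatFunc k) E]
    (ι : E →ₐ[k] FractionRing (PowerSeries k)) {t : E} (ht : algebraMap (RatFunc k) E RatFunc.X = t)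
    (hι : ι t = algebraMap _ _ (PowerSeries.X : PowerSeries k)) {m n : ℕ}
    (hm : Module.finrank (RatFunc k) E * n < m) {s : K} (hs0 : s ≠ 0)
    (hst : s ^ m = algebraMap E K t)
    {ζ : k} (hζ : IsPrimitiveRoot ζ m) (τ : K →ₐ[E] K) (hτ : τ s = algebraMap k K ζ * s)
    (hgen : ∀ g : K, ∃ c : ℕ → E, g = ∑ i ∈ Finset.range m, algebraMap E K (c i) * s ^ i)
    {g : K} (h1 : g ∈ intOver k s) (h2 : g * s⁻¹ ^ n ∈ intOver k s⁻¹) :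
    ∃ Q : k[X], aeval s Q = g := by
  obtain ⟨c, hc⟩ := hgen g
  have hm0 : 0 < m := by omega
  have hζ0 : ζ ≠ 0 := hζ.ne_zero hm0.ne'
  have hinj : Set.InjOn (fun i ↦ ζ ^ i) (Finset.range m : Set ℕ) := fun i hi j hj hij ↦
    hζ.pow_inj (by simpa using hi) (by simpa using hj) hij
  have hτ' : (τ.restrictScalars k) s⁻¹ = algebraMap k K ζ⁻¹ * s⁻¹ := by
    rw [map_inv₀, map_inv₀, AlgHom.restrictScalars_apply, hτ, mul_inv]
  have h3 := mem_intOver_of_sum_mem (τ.restrictScalars k) hτ (fun i ↦ ζ ^ i) (Finset.range m) hinj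
    (fun i ↦ algebraMap E K (c i) * s ^ i) (fun i _ ↦ by
      rw [AlgHom.restrictScalars_apply, map_mul, map_pow, hτ, AlgHom.commutes, Algebra.smul_def,
        map_pow]
      ring) (hc ▸ h1)
  have h4 := mem_intOver_of_sum_mem (τ.restrictScalars k) hτ' (fun i ↦ ζ ^ i * ζ⁻¹ ^ n)
    (Finset.range m) (fun i hi j hj hij ↦ hinj hi hj (mul_right_cancel₀
      (pow_ne_zero _ (inv_ne_zero hζ0)) hij))
    (fun i ↦ algebraMap E K (c i) * s ^ i * s⁻¹ ^ n) (fun i _ ↦ by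
      rw [map_mul, map_mul, map_pow, map_pow, hτ', AlgHom.restrictScalars_apply,
        AlgHom.restrictScalars_apply, hτ, AlgHom.commutes, Algebra.smul_def,
        map_mul, map_pow, map_pow]
      ring) (by rwa [← Finset.sum_mul, ← hc])
  have h5 : ∀ i ∈ Finset.range m, ∃ a : k, algebraMap k E a = c i := fun i hi ↦ by
    refine eq_algebraMap_of_mem_intOver ι ht hι (Finset.mem_range.mp hi) hm
      (mem_intOver_of_mul_pow_mem hm0 hst (h3 i hi)) ?_
    refine mem_intOver_of_mul_pow_mem (s := s⁻¹) hm0 (by rw [inv_pow, hst, map_inv₀]) ?_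
    convert mul_mem (h4 i hi) (pow_mem (self_mem_intOver (k := k) s⁻¹) i) using 1
    rw [mul_right_comm, mul_assoc _ (s ^ i), ← mul_pow, mul_inv_cancel₀ hs0, one_pow, mul_one]
  choose! a ha using h5
  refine ⟨∑ i ∈ Finset.range m, C (a i) * X ^ i, ?_⟩
  rw [hc, map_sum]
  refine Finset.sum_congr rfl fun i hi ↦ ?_
  rw [map_mul, map_pow, aeval_X, aeval_C, ← ha i hi, ← IsScalarTower.algebraMap_apply]

end

section
variable {k : Type*} [Field k] {K : Type*} [Field K] [Algebra k K] [Algebra (RatFunc k) K]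
  [IsScalarTower k (RatFunc k) K]

theorem algebraMap_ratFunc_coe (P : k[X]) :
    algebraMap (RatFunc k) K (algebraMap k[X] (RatFunc k) P) =
      aeval (algebraMap (RatFunc k) K RatFunc.X) P := by
  rw [aeval_algebraMap_apply, RatFunc.aeval_X_left_eq_algebraMap]

theorem transcendental_algebraMap_ratFunc_X :
    Transcendental k (algebraMap (RatFunc k) K RatFunc.X) :=
  (transcendental_algebraMap_iff (algebraMap (RatFunc k) K).injective).mpr
    RatFunc.transcendental_X

theorem exists_bivariate_eval_eq_zero [FiniteDimensional (RatFunc k) K] {n : ℕ}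
    (hn : Module.finrank (RatFunc k) K ≤ n) (φ : K ≃ₐ[k] K) {s : K}
    (hs : algebraMap (RatFunc k) K RatFunc.X = s) :
    ∃ P : k[X][X], P ≠ 0 ∧ (∀ i, (P.coeff i).natDegree ≤ n) ∧
      (P.map (aeval s : k[X] →ₐ[k] K).toRingHom).eval (φ s) = 0 := by
  obtain ⟨r, hr, i, hi⟩ : ∃ r : Fin (n + 1) → RatFunc k, ∑ j, r j • (φ.symm s) ^ (j : ℕ) = 0 ∧
      ∃ i, r i ≠ 0 := by
    rw [← Fintype.not_linearIndependent_iff]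
    intro h
    have := h.fintype_card_le_finrank
    simp at this
    omega
  obtain ⟨b, hb⟩ := IsLocalization.exist_integer_multiples_of_finite (nonZeroDivisors k[X]) r
  choose a ha using hb
  have hb0 : algebraMap k[X] (RatFunc k) b ≠ 0 := by
    simp
  have hsum : ∑ j, aeval s (a j) * (φ.symm s) ^ (j : ℕ) = 0 := by
    rw [← mul_zero (algebraMap (RatFunc k) K (algebraMap k[X] (RatFunc k) b)), ← hr, Finset.mul_sum]
    refine Finset.sum_congr rfl fun j _ ↦ ?_
    rw [← hs, ← algebraMap_ratFunc_coe, ha, Algebra.smul_def, Algebra.smul_def, map_mul, mul_assoc]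
  have hsum' : ∑ j, aeval (φ s) (a j) * s ^ (j : ℕ) = 0 := by
    rw [← map_zero φ, ← hsum, map_sum]
    refine Finset.sum_congr rfl fun j _ ↦ ?_
    rw [map_mul, map_pow, AlgEquiv.apply_symm_apply, ← aeval_algHom_apply]
  have hcoeff : ∀ l, (∑ j : Fin (n + 1), (a j).map C * C (X ^ (j : ℕ)) : k[X][X]).coeff l =
      ∑ j : Fin (n + 1), C ((a j).coeff l) * X ^ (j : ℕ) := fun l ↦ by
    rw [finsetSum_coeff]
    exact Finset.sum_congr rfl fun j _ ↦ by rw [coeff_mul_C, coeff_map]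
  refine ⟨∑ j, (a j).map C * C (X ^ (j : ℕ)), ?_, ?_, ?_⟩
  · intro h0
    have hai : a i ≠ 0 := by
      intro h1
      have := ha i
      rw [h1, map_zero, Algebra.smul_def, eq_comm] at this
      exact (mul_ne_zero hb0 hi) this
    apply hai
    ext l
    have := congrArg (fun p ↦ coeff p i) (hcoeff l)
    simpa [h0, finsetSum_coeff, coeff_X_pow, Fin.val_inj, -map_pow] using this.symm
  · intro l
    rw [hcoeff]
    refine natDegree_sum_le_of_forall_le _ _ fun j _ ↦ (natDegree_C_mul_X_pow_le _ _).trans ?_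
    omega
  · rw [← hsum', Polynomial.map_sum, eval_finsetSum]
    refine Finset.sum_congr rfl fun j _ ↦ ?_
    rw [Polynomial.map_mul, Polynomial.map_map, eval_mul, eval_map, map_C, eval_C, aeval_def]
    congr 1
    · congr 1
      ext; simp
    · simp
end

/-- A Kummer extension `K = E(t ^ (1 / m))`, with the automorphisms of `E` fixing `t` lifted so as
to fix the chosen root of `t`. -/
theorem exists_kummer_extension {k E : Type} [Field k] [Field E] [Algebra k E] {t : E} {m : ℕ}
    (hm : m ≠ 0) (hirr : Irreducible (X ^ m - C t : E[X])) {ζ : k} (hζ : ζ ^ m = 1)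
    {G : Type*} [Group G] (ρ : G →* (E ≃ₐ[k] E)) (hρ : ∀ g, ρ g t = t) :
    ∃ (K : Type) (_ : Field K) (_ : Algebra k K) (_ : Algebra E K) (_ : IsScalarTower k E K)
      (s : K) (τ : K →ₐ[E] K) (ρ' : G →* (K ≃ₐ[k] K)), s ^ m = algebraMap E K t ∧
      (∀ g : K, ∃ c : ℕ → E, g = ∑ i ∈ Finset.range m, algebraMap E K (c i) * s ^ i) ∧
      τ s = algebraMap k K ζ * s ∧ (∀ g, ρ' g s = s) ∧
      ∀ g e, ρ' g (algebraMap E K e) = algebraMap E K (ρ g e) := by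
  have := Fact.mk hirr
  have hs : AdjoinRoot.root (X ^ m - C t) ^ m = algebraMap E _ t := by
    have := AdjoinRoot.eval₂_root (X ^ m - C t)
    rw [eval₂_sub, eval₂_pow, eval₂_X, eval₂_C, sub_eq_zero] at this
    exact this
  have hmap (g : G) : (X ^ m - C t : E[X]).map (ρ g : E →+* E) = X ^ m - C t := by
    rw [Polynomial.map_sub, Polynomial.map_pow, map_X, map_C]
    exact congrArg _ (congrArg _ (hρ g))
  let lift : G → (AdjoinRoot (X ^ m - C t) ≃ₐ[k] AdjoinRoot (X ^ m - C t)) := fun g ↦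
    AdjoinRoot.mapAlgEquiv (ρ g) _ _ (Associated.of_eq (hmap g))
  have hroot (g : G) : lift g (AdjoinRoot.root _) = AdjoinRoot.root _ := by
    simp [lift]
  have hof (g : G) (e : E) : lift g (AdjoinRoot.of _ e) = AdjoinRoot.of _ (ρ g e) := by
    simp [lift]
  have hext (σ τ : AdjoinRoot (X ^ m - C t) ≃ₐ[k] AdjoinRoot (X ^ m - C t))
      (h1 : σ (AdjoinRoot.root _) = τ (AdjoinRoot.root _))
      (h2 : ∀ e, σ (AdjoinRoot.of _ e) = τ (AdjoinRoot.of _ e)) : σ = τ := by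
    ext x
    obtain ⟨p, rfl⟩ := AdjoinRoot.mk_surjective x
    induction p using Polynomial.induction_on' with
    | add p q hp hq => rw [map_add, map_add, map_add, hp, hq]
    | monomial n a =>
      rw [← C_mul_X_pow_eq_monomial, map_mul, map_pow, AdjoinRoot.mk_X, AdjoinRoot.mk_C, map_mul,
        map_mul, map_pow, map_pow, h1, h2]
  refine ⟨AdjoinRoot (X ^ m - C t), inferInstance, inferInstance, inferInstance, inferInstance,
    AdjoinRoot.root _, AdjoinRoot.liftAlgHom _ (Algebra.ofId E _)
      (algebraMap k _ ζ * AdjoinRoot.root _) ?_,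
    ⟨⟨lift, hext _ _ ?_ ?_⟩, fun g h ↦ hext _ _ ?_ ?_⟩, hs, ?_, ?_, hroot, hof⟩
  · rw [eval₂_sub, eval₂_pow, eval₂_X, eval₂_C, mul_pow, hs, ← map_pow, hζ, map_one, one_mul,
      sub_eq_zero]
    rfl
  · exact hroot 1
  · intro e
    rw [hof, map_one]; rfl
  · rw [hroot, AlgEquiv.mul_apply, hroot, hroot]
  · intro e
    rw [hof, AlgEquiv.mul_apply, hof, hof, map_mul]; rfl
  · intro g
    obtain ⟨p, rfl⟩ := AdjoinRoot.mk_surjective g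
    have hmon : (X ^ m - C t : E[X]).Monic := monic_X_pow_sub_C t hm
    refine ⟨(p %ₘ (X ^ m - C t)).coeff, ?_⟩
    have h1 : AdjoinRoot.mk (X ^ m - C t) p = AdjoinRoot.mk _ (p %ₘ (X ^ m - C t)) := by
      conv_lhs => rw [← modByMonic_add_div p (X ^ m - C t)]
      simp
    have h2 : (p %ₘ (X ^ m - C t)).natDegree < m := by
      have := natDegree_modByMonic_lt p hmon (by
        intro h
        have := congrArg natDegree h
        rw [natDegree_X_pow_sub_C, natDegree_one] at this
        exact hm this)
      rwa [natDegree_X_pow_sub_C] at this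
    rw [h1]
    conv_lhs => rw [as_sum_range' _ m h2]
    rw [map_sum]
    refine Finset.sum_congr rfl fun i _ ↦ ?_
    rw [← C_mul_X_pow_eq_monomial, map_mul, map_pow, AdjoinRoot.mk_X, AdjoinRoot.mk_C]
    rfl
  · simp

section
variable {k : Type*} [Field k] {K : Type*} [Field K] [Algebra k K] [Algebra (RatFunc k) K]
  [IsScalarTower k (RatFunc k) K]

theorem algEquiv_apply_algebraMap_ratFunc {L : Type*} [Field L] [Algebra k L] [Algebra (RatFunc k) L]
    [IsScalarTower k (RatFunc k) L] {φ : K →ₐ[k] L}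
    (h : φ (algebraMap (RatFunc k) K RatFunc.X) = algebraMap (RatFunc k) L RatFunc.X)
    (r : RatFunc k) : φ (algebraMap (RatFunc k) K r) = algebraMap (RatFunc k) L r := by
  induction r using RatFunc.induction_on with
  | f p q hq =>
    rw [map_div₀, map_div₀, map_div₀, algebraMap_ratFunc_coe, algebraMap_ratFunc_coe,
      algebraMap_ratFunc_coe, algebraMap_ratFunc_coe, ← aeval_algHom_apply, ← aeval_algHom_apply, h]
end

theorem pow_ne_of_isUniformizer {k E : Type*} [Field k] [Field E] [Algebra k E]
    {ι : E →ₐ[k] FractionRing (PowerSeries k)} {t : E}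
    (hι : ι t = algebraMap _ _ (PowerSeries.X : PowerSeries k)) {m : ℕ} (hm : 1 < m) (b : E) :
    b ^ m ≠ t := by
  rintro rfl
  obtain ⟨w, hw⟩ := exists_coe_of_mem_intOver hι
    (mem_intOver_of_pow_mem (by omega) (self_mem_intOver (k := k) (b ^ m)))
  rw [map_pow, ← hw, ← map_pow] at hι
  have h := IsFractionRing.injective (PowerSeries k) (FractionRing (PowerSeries k)) hι
  have := (PowerSeries.X_prime (R := k)).irreducible
  rw [← h] at this
  exact not_irreducible_pow (by omega) this

section
variable {k : Type*} [Field k] {E K : Type*} [Field E] [Algebra k E] [Algebra (RatFunc k) E]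
  [IsScalarTower k (RatFunc k) E] [Field K] [Algebra k K] [Algebra (RatFunc k) K]
  [IsScalarTower k (RatFunc k) K] [Algebra E K] [IsScalarTower k E K]

theorem span_image_basis_eq_top {s : K} {t : E} {m : ℕ} (ht : algebraMap (RatFunc k) E RatFunc.X = t)
    (hs : algebraMap (RatFunc k) K RatFunc.X = s) (hst : s ^ m = algebraMap E K t)
    (hgen : ∀ g : K, ∃ c : ℕ → E, g = ∑ i ∈ Finset.range m, algebraMap E K (c i) * s ^ i)
    {ι : Type*} (b : Module.Basis ι (RatFunc k) E) :
    Submodule.span (RatFunc k) (Set.range fun i ↦ algebraMap E K (b i)) = ⊤ := by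
  have h1 (P : k[X]) : algebraMap E K (algebraMap (RatFunc k) E (algebraMap k[X] (RatFunc k) P)) =
      algebraMap (RatFunc k) K (aeval (RatFunc.X ^ m) P) := by
    rw [algebraMap_ratFunc_coe, ht, ← aeval_algebraMap_apply, ← hst, ← hs, ← map_pow,
      ← aeval_algebraMap_apply]
  have h2 (r : RatFunc k) : ∃ r' : RatFunc k,
      algebraMap E K (algebraMap (RatFunc k) E r) = algebraMap (RatFunc k) K r' := by
    induction r using RatFunc.induction_on with
    | f p q hq =>
      exact ⟨aeval (RatFunc.X ^ m) p / aeval (RatFunc.X ^ m) q, by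
        rw [map_div₀, map_div₀, map_div₀, h1, h1]⟩
  have h3 (e : E) :
      algebraMap E K e ∈ Submodule.span (RatFunc k) (Set.range fun i ↦ algebraMap E K (b i)) := by
    rw [← b.linearCombination_repr e, Finsupp.linearCombination_apply, Finsupp.sum, map_sum]
    refine Submodule.sum_mem _ fun i _ ↦ ?_
    obtain ⟨r', hr'⟩ := h2 (b.repr e i)
    rw [Algebra.smul_def, map_mul, hr', ← Algebra.smul_def]
    exact Submodule.smul_mem _ _ (Submodule.subset_span ⟨i, rfl⟩)
  rw [eq_top_iff]
  intro g _
  obtain ⟨c, rfl⟩ := hgen g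
  refine Submodule.sum_mem _ fun i _ ↦ ?_
  rw [mul_comm, ← hs, ← map_pow, ← Algebra.smul_def]
  exact Submodule.smul_mem _ _ (h3 _)

end

theorem exists_functionField_of_finite_group (k : Type) [Field k] [IsAlgClosed k] [CharZero k]
    (G : Type) [Group G] [Finite G] :
    ∃ (K : Type) (_ : Field K) (_ : Algebra k K) (_ : Algebra (RatFunc k) K)
      (_ : IsScalarTower k (RatFunc k) K) (_ : FiniteDimensional (RatFunc k) K)
      (ρ : G →* (K ≃ₐ[RatFunc k] K)), Function.Injective ρ ∧ ¬ Function.Surjective ρ ∧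
      ∀ φ : K ≃ₐ[k] K, ∃ r : RatFunc k,
        φ (algebraMap (RatFunc k) K RatFunc.X) = algebraMap (RatFunc k) K r := by
  obtain ⟨E, _, _, _, _, _, _, ρ, ι, hinj, hsurj, hι⟩ := exists_isGalois_of_finite_group k G
  set t : E := algebraMap (RatFunc k) E RatFunc.X with ht
  set n := Module.finrank (RatFunc k) E with hn
  obtain ⟨m, hnm, hmp⟩ := Nat.exists_infinite_primes (n * n + 1)
  have hm0 : NeZero (m : k) := ⟨by exact_mod_cast hmp.ne_zero⟩
  obtain ⟨ζ, hζ⟩ := HasEnoughRootsOfUnity.exists_primitiveRoot k m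
  obtain ⟨K, _, _, _, _, s, τ, ρ', hst, hgen, hτ, hρs, hρE⟩ := exists_kummer_extension hmp.ne_zero
    (X_pow_sub_C_irreducible_of_prime hmp (pow_ne_of_isUniformizer hι hmp.one_lt)) hζ.pow_eq_one
    (AlgEquiv.restrictScalarsHom k : (E ≃ₐ[RatFunc k] E) →* (E ≃ₐ[k] E))
    (fun σ ↦ σ.commutes RatFunc.X)
  have hts : Transcendental k s := by
    intro h
    have h1 : IsAlgebraic k (algebraMap E K t) := hst ▸ h.pow m
    rw [isAlgebraic_algebraMap_iff (algebraMap E K).injective] at h1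
    exact transcendental_algebraMap_ratFunc_X h1
  have hle := nonZeroDivisors_le_comap_nonZeroDivisors_of_injective (aeval s : k[X] →ₐ[k] K)
    (transcendental_iff_injective.mp hts)
  let := (RatFunc.liftAlgHom (aeval s : k[X] →ₐ[k] K) hle).toAlgebra
  have : IsScalarTower k (RatFunc k) K := IsScalarTower.of_algHom _
  have hs : algebraMap (RatFunc k) K RatFunc.X = s := by
    have := RatFunc.liftAlgHom_apply_div' (aeval s : k[X] →ₐ[k] K) hle X 1
    rwa [map_one, map_one, div_one, map_one, div_one, aeval_X, RatFunc.algebraMap_X] at this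
  have hs0 : s ≠ 0 := by
    rintro rfl
    exact hts isAlgebraic_zero
  let b := Module.finBasis (RatFunc k) E
  have hspan := span_image_basis_eq_top rfl hs hst hgen b
  have hfin : FiniteDimensional (RatFunc k) K := ⟨Submodule.fg_def.mpr
    ⟨_, Set.finite_range _, hspan⟩⟩
  have hrank : Module.finrank (RatFunc k) K ≤ n := by
    rw [← finrank_top, ← hspan]
    exact (finrank_range_le_card (R := RatFunc k) fun i ↦ algebraMap E K (b i)).trans_eq
      (Fintype.card_fin _)
  let ρ'' : (E ≃ₐ[RatFunc k] E) →* (K ≃ₐ[RatFunc k] K) :=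
    { toFun := fun g ↦ AlgEquiv.ofRingEquiv (f := (ρ' g : K ≃+* K)) (fun r ↦
        algEquiv_apply_algebraMap_ratFunc (φ := (ρ' g : K →ₐ[k] K)) (by rw [hs]; exact hρs g) r)
      map_one' := by
        ext x
        exact congrArg (fun f : K ≃ₐ[k] K ↦ f x) (map_one ρ')
      map_mul' := fun g h ↦ by
        ext x
        exact congrArg (fun f : K ≃ₐ[k] K ↦ f x) (map_mul ρ' g h) }
  have hρ''E (g e) : ρ'' g (algebraMap E K e) = algebraMap E K (g e) := hρE g e
  have hρ'' : Function.Injective ρ'' := fun g h hgh ↦ by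
    ext e
    apply (algebraMap E K).injective
    rw [← hρ''E, ← hρ''E, hgh]
  refine ⟨K, inferInstance, inferInstance, inferInstance, inferInstance, hfin, ρ''.comp ρ,
    hρ''.comp hinj, fun h ↦ hsurj fun g ↦ ?_, fun φ ↦ ?_⟩
  · obtain ⟨x, hx⟩ := h (ρ'' g)
    exact ⟨x, hρ'' hx⟩
  · obtain ⟨P, hP, hdeg, hev⟩ := exists_bivariate_eval_eq_zero hrank φ hs
    obtain ⟨q, hq, h1, h2⟩ := exists_mul_mem_intOver hts hP hdeg hev
    obtain ⟨Q, hQ⟩ := exists_aeval_eq_of_mem_intOver ι rfl hι hnm hs0 hst hζ τ hτ hgen h1 h2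
    refine ⟨algebraMap k[X] _ Q / algebraMap k[X] _ q, ?_⟩
    rw [map_div₀, algebraMap_ratFunc_coe, algebraMap_ratFunc_coe, hs, hQ, mul_div_cancel_left₀]
    exact (map_ne_zero_iff _ (transcendental_iff_injective.mp hts)).mpr hq

section
variable {k : Type*} [Field k]

theorem C_mul_X_add_C_ne_zero {a b : k} (h : a ≠ 0 ∨ b ≠ 0) : C a * X + C b ≠ 0 := by
  intro h0
  have h1 := congrArg (fun p ↦ coeff p 1) h0
  have h2 := congrArg (fun p ↦ coeff p 0) h0
  simp at h1 h2
  tauto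

theorem eq_zero_of_three_roots {p : k[X]} (hp : p.natDegree ≤ 2) {a : Fin 3 → k}
    (ha : Function.Injective a) (h : ∀ i, p.eval (a i) = 0) : p = 0 :=
  eq_zero_of_natDegree_lt_card_of_eval_eq_zero p ha h (by simpa using! Nat.lt_succ_of_le hp)

theorem exists_polynomial_moebius_apply_notMem [DecidableEq k] (T : Finset k) {a : Fin 3 → k}
    (ha : Function.Injective a) (b : Fin 3 → k) :
    ∃ R : k[X], R ≠ 0 ∧ ∀ α β γ δ : k, α * δ - β * γ ≠ 0 → ¬ (γ = 0 ∧ β = 0 ∧ α = δ) →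
      (∀ i, α - γ * a i ≠ 0 ∧ δ * a i - β = b i * (α - γ * a i)) →
      ∀ x, R.eval x ≠ 0 → α - γ * x ≠ 0 ∧ (δ * x - β) / (α - γ * x) ∉ insert x T := by
  by_cases hex : ∃ α β γ δ : k, α * δ - β * γ ≠ 0 ∧ ¬ (γ = 0 ∧ β = 0 ∧ α = δ) ∧
      (∀ i, α - γ * a i ≠ 0 ∧ δ * a i - β = b i * (α - γ * a i))
  swap
  · refine ⟨1, one_ne_zero, fun α β γ δ h1 h2 h3 ↦ (hex ⟨α, β, γ, δ, h1, h2, h3⟩).elim⟩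
  obtain ⟨α₀, β₀, γ₀, δ₀, h1, h2, h3⟩ := hex
  refine ⟨(C (-γ₀) * X + C α₀) * (C γ₀ * X ^ 2 + C (δ₀ - α₀) * X + C (-β₀)) *
    ∏ y ∈ T, (C (δ₀ + y * γ₀) * X + C (-β₀ - y * α₀)), ?_, ?_⟩
  · refine mul_ne_zero (mul_ne_zero ?_ ?_) (Finset.prod_ne_zero_iff.mpr fun y _ ↦ ?_)
    · apply C_mul_X_add_C_ne_zero
      by_contra! h
      apply h1
      rw [neg_eq_zero.mp h.1, h.2]; ring
    · intro h0
      have e0 := congrArg (fun p ↦ coeff p 0) h0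
      have e1 := congrArg (fun p ↦ coeff p 1) h0
      have e2 := congrArg (fun p ↦ coeff p 2) h0
      simp [coeff_X, coeff_C] at e0 e1 e2
      exact h2 ⟨e2, e0, (sub_eq_zero.mp e1).symm⟩
    · apply C_mul_X_add_C_ne_zero
      by_contra! h
      apply h1
      linear_combination α₀ * h.1 + γ₀ * h.2
  · intro α β γ δ hdet _ hab x hx
    have hpoly : (C δ * X - C β) * (C α₀ - C γ₀ * X) - (C δ₀ * X - C β₀) * (C α - C γ * X) = 0 := by
      refine eq_zero_of_three_roots (by compute_degree) ha fun i ↦ ?_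
      simp only [eval_sub, eval_mul, eval_C, eval_X]
      rw [(hab i).2, (h3 i).2]; ring
    have hpx := congrArg (eval x) hpoly
    simp only [eval_sub, eval_mul, eval_C, eval_X, eval_zero, eval_add, eval_pow, eval_prod,
      mul_ne_zero_iff, Finset.prod_ne_zero_iff] at hpx hx
    obtain ⟨⟨hx1, hx2⟩, hx3⟩ := hx
    have hx1' : α₀ - γ₀ * x ≠ 0 := fun h ↦ hx1 (by linear_combination h)
    have hne : α - γ * x ≠ 0 := by
      intro h
      rw [h, mul_zero, sub_zero] at hpx
      have h4 := (mul_eq_zero.mp hpx).resolve_right hx1'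
      apply hdet
      linear_combination δ * h + γ * h4
    refine ⟨hne, ?_⟩
    have heq : (δ * x - β) / (α - γ * x) = (δ₀ * x - β₀) / (α₀ - γ₀ * x) := by
      rw [div_eq_div_iff hne hx1']
      linear_combination hpx
    rw [heq, Finset.mem_insert, not_or, div_eq_iff hx1']
    refine ⟨fun h ↦ hx2 (by linear_combination h), fun h ↦ hx3 _ h ?_⟩
    linear_combination -(div_mul_cancel₀ (δ₀ * x - β₀) hx1')

/-- Every finite set can be enlarged to a finite set `T` such that the only Möbius transformation
mapping `T ∪ {∞}` into itself is the identity. -/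
theorem exists_finset_moebius_rigid [Infinite k] (T₀ : Finset k) :
    ∃ T : Finset k, T₀ ⊆ T ∧ ∀ α β γ δ : k, α * δ - β * γ ≠ 0 →
      (∀ a ∈ T, α - γ * a ≠ 0 → (δ * a - β) / (α - γ * a) ∈ T) → γ = 0 ∧ β = 0 ∧ α = δ := by
  classical
  obtain ⟨T₁, hT₁, hcard⟩ := Infinite.exists_superset_card_eq T₀ (T₀.card + 5) (by omega)
  choose! R hR0 hR using fun (a : Fin 3 → k) (ha : Function.Injective a) ↦
    fun b ↦ exists_polynomial_moebius_apply_notMem T₁ ha b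
  let S := Fintype.piFinset fun _ : Fin 3 ↦ T₁
  have hprod : ∏ a ∈ S with Function.Injective a, ∏ b ∈ S, R a b ≠ 0 :=
    Finset.prod_ne_zero_iff.mpr fun a ha ↦ Finset.prod_ne_zero_iff.mpr fun b _ ↦
      hR0 a (Finset.mem_filter.mp ha).2 b
  obtain ⟨x, hx⟩ := exists_eval_ne_zero_of_natDegree_lt_card _ hprod (by
    exact (Cardinal.natCast_lt_aleph0).trans_le (Cardinal.aleph0_le_mk k))
  refine ⟨insert x T₁, hT₁.trans (Finset.subset_insert _ _), fun α β γ δ hdet hT ↦ ?_⟩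
  by_contra hscal
  have hpole : (T₁.filter fun a ↦ α - γ * a = 0).card ≤ 1 := by
    refine Finset.card_le_one.mpr fun a ha b hb ↦ ?_
    have ha := (Finset.mem_filter.mp ha).2
    have hb := (Finset.mem_filter.mp hb).2
    have hγ : γ ≠ 0 := by
      rintro rfl
      apply hdet
      linear_combination δ * ha
    exact mul_left_cancel₀ hγ (by linear_combination hb - ha)
  have hxx : (T₁.filter fun a ↦ α - γ * a ≠ 0 ∧ (δ * a - β) / (α - γ * a) = x).card ≤ 1 := by
    refine Finset.card_le_one.mpr fun a ha b hb ↦ ?_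
    obtain ⟨-, ha, ha'⟩ := Finset.mem_filter.mp ha
    obtain ⟨-, hb, hb'⟩ := Finset.mem_filter.mp hb
    rw [← hb', div_eq_div_iff ha hb] at ha'
    exact mul_left_cancel₀ hdet (by linear_combination ha')
  have hgood : 3 ≤ (T₁.filter fun a ↦ α - γ * a ≠ 0 ∧ (δ * a - β) / (α - γ * a) ≠ x).card := by
    have : T₁ ⊆ (T₁.filter fun a ↦ α - γ * a = 0) ∪
        (T₁.filter fun a ↦ α - γ * a ≠ 0 ∧ (δ * a - β) / (α - γ * a) = x) ∪
        (T₁.filter fun a ↦ α - γ * a ≠ 0 ∧ (δ * a - β) / (α - γ * a) ≠ x) := by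
      intro a ha
      simp only [Finset.mem_union, Finset.mem_filter, ha, true_and]
      tauto
    have h1 := Finset.card_le_card this
    have h2 := Finset.card_union_le ((T₁.filter fun a ↦ α - γ * a = 0) ∪
        (T₁.filter fun a ↦ α - γ * a ≠ 0 ∧ (δ * a - β) / (α - γ * a) = x))
        (T₁.filter fun a ↦ α - γ * a ≠ 0 ∧ (δ * a - β) / (α - γ * a) ≠ x)
    have h3 := Finset.card_union_le (T₁.filter fun a ↦ α - γ * a = 0)
        (T₁.filter fun a ↦ α - γ * a ≠ 0 ∧ (δ * a - β) / (α - γ * a) = x)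
    omega
  obtain ⟨U, hU, hU3⟩ := Finset.exists_subset_card_eq hgood
  let a : Fin 3 → k := fun i ↦ (U.equivFinOfCardEq hU3).symm i
  have haU (i) : a i ∈ U := ((U.equivFinOfCardEq hU3).symm i).2
  have ha : Function.Injective a := Subtype.val_injective.comp (Equiv.injective _)
  have hmem (i) := Finset.mem_filter.mp (hU (haU i))
  have hbT (i) : (δ * a i - β) / (α - γ * a i) ∈ T₁ :=
    (Finset.mem_insert.mp (hT _ (Finset.mem_insert_of_mem (hmem i).1) (hmem i).2.1)).resolve_left
      (hmem i).2.2
  rw [eval_prod, Finset.prod_ne_zero_iff] at hx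
  have hx := hx a (Finset.mem_filter.mpr ⟨Fintype.mem_piFinset.mpr fun i ↦ (hmem i).1, ha⟩)
  rw [eval_prod, Finset.prod_ne_zero_iff] at hx
  obtain ⟨h1, h2⟩ := hR a ha _ α β γ δ hdet hscal
    (fun i ↦ ⟨(hmem i).2.1, (div_mul_cancel₀ _ (hmem i).2.1).symm⟩) x
    (hx _ (Fintype.mem_piFinset.mpr hbT))
  exact h2 (hT x (Finset.mem_insert_self _ _) h1)
end

section
variable {R K : Type*} [CommRing R] [Field K] [Algebra R K]

/-- The subalgebra `C[1/v]` of a field `K`, for a subalgebra `C` and an element `v` of `C`. -/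
def Subalgebra.away (C : Subalgebra R K) (v : C) : Subalgebra R K where
  carrier := {x | ∃ n : ℕ, x * (v : K) ^ n ∈ C}
  mul_mem' := by
    rintro x y ⟨n, hn⟩ ⟨m, hm⟩
    refine ⟨n + m, ?_⟩
    convert mul_mem hn hm using 1
    ring
  add_mem' := by
    rintro x y ⟨n, hn⟩ ⟨m, hm⟩
    refine ⟨n + m, ?_⟩
    convert add_mem (mul_mem hn (pow_mem v.2 m)) (mul_mem hm (pow_mem v.2 n)) using 1
    ring
  algebraMap_mem' r := ⟨0, by simp [C.algebraMap_mem]⟩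

theorem Subalgebra.mem_away {C : Subalgebra R K} {v : C} {x : K} :
    x ∈ C.away v ↔ ∃ n : ℕ, x * (v : K) ^ n ∈ C := Iff.rfl

theorem Subalgebra.le_away (C : Subalgebra R K) (v : C) : C ≤ C.away v :=
  fun x hx ↦ ⟨0, by simpa using hx⟩

theorem Subalgebra.inv_mem_away (C : Subalgebra R K) {v : C} (hv : (v : K) ≠ 0) :
    (v : K)⁻¹ ∈ C.away v :=
  ⟨1, by simp [hv, C.one_mem]⟩

theorem Subalgebra.away_away (C : Subalgebra R K) (q : C) (w : C.away q) (u : C) {N : ℕ}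
    (hu : (u : K) = w * (q : K) ^ N) :
    (C.away q).away w = C.away (q * u) := by
  ext x
  simp only [mem_away, MulMemClass.coe_mul, hu]
  constructor
  · rintro ⟨n, m, h⟩
    refine ⟨n + m, ?_⟩
    have h1 := mul_mem (mul_mem h (pow_mem (hu ▸ u.2 : (w : K) * (q : K) ^ N ∈ C) m))
      (pow_mem q.2 (n * (N + 1)))
    convert h1 using 1
    ring
  · rintro ⟨n, h⟩
    refine ⟨n, n * (N + 1), ?_⟩
    convert h using 1
    ring

theorem Subalgebra.isLocalization_away (C : Subalgebra R K) {v : C} (hv : (v : K) ≠ 0) :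
    @IsLocalization.Away C _ v (C.away v) _ (Subalgebra.inclusion (C.le_away v)).toAlgebra := by
  let : Algebra C (C.away v) := (Subalgebra.inclusion (C.le_away v)).toAlgebra
  refine ⟨?_, ?_, ?_⟩
  · rintro ⟨_, n, rfl⟩
    rw [map_pow]
    refine IsUnit.pow n (.of_mul_eq_one ⟨_, C.inv_mem_away hv⟩ ?_)
    exact Subtype.ext (mul_inv_cancel₀ hv)
  · rintro ⟨x, n, hn⟩
    exact ⟨⟨⟨_, hn⟩, ⟨v ^ n, n, rfl⟩⟩, Subtype.ext (by rfl)⟩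
  · intro x y h
    exact ⟨1, by rw [Subalgebra.inclusion_injective (C.le_away v) h]⟩

theorem Subalgebra.dimensionLEOne_away [IsDomain R] [Ring.DimensionLEOne R]
    [FaithfulSMul R K] (C : Subalgebra R K)
    [Algebra.IsIntegral R C] (v : C) (hv : (v : K) ≠ 0) : Ring.DimensionLEOne (C.away v) := by
  let : Algebra C (C.away v) := (Subalgebra.inclusion (C.le_away v)).toAlgebra
  have := C.isLocalization_away hv
  have := Ring.DimensionLEOne.of_isIntegral R C
  refine Ring.DimensionLEOne.localization (R := C) (C.away v) (M := .powers v) ?_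
  refine powers_le_nonZeroDivisors_of_noZeroDivisors fun h ↦ hv (by simp [h])

theorem Subalgebra.isStandardEtale_away [IsDomain R] [IsIntegrallyClosed R] [FaithfulSMul R K]
    {θ : K} (hθ : IsIntegral R θ) (v : Algebra.adjoin R {θ}) (hv : (v : K) ≠ 0)
    (hd : (aeval θ (derivative (minpoly R θ)))⁻¹ ∈ (Algebra.adjoin R {θ}).away v)
    (hd0 : aeval θ (derivative (minpoly R θ)) ≠ 0) :
    Algebra.IsStandardEtale R ((Algebra.adjoin R {θ}).away v) := by
  have key : ∀ x ∈ Algebra.adjoin R {θ}, ∃ p : R[X], aeval θ p = x := fun x hx ↦ by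
    rwa [Algebra.adjoin_singleton_eq_range_aeval] at hx
  have hdvd (p : R[X]) (hp : aeval θ p = 0) : minpoly R θ ∣ p :=
    minpoly.isIntegrallyClosed_dvd hθ hp
  obtain ⟨g, hg⟩ := key v v.2
  have hcond : ∃ p₁ p₂ n, derivative (minpoly R θ) * p₁ + minpoly R θ * p₂ = g ^ n := by
    obtain ⟨n, hn⟩ := hd
    obtain ⟨p, hp⟩ := key _ hn
    obtain ⟨c, hc⟩ := hdvd (g ^ n - derivative (minpoly R θ) * p) (by
      simp only [map_sub, map_mul, map_pow, hg, hp]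
      field_simp
      ring)
    exact ⟨p, c, n, by rw [← hc]; ring⟩
  let P : StandardEtalePair R := ⟨minpoly R θ, minpoly.monic hθ, g, hcond⟩
  set A := (Algebra.adjoin R {θ}).away v
  let x : A := ⟨θ, Subalgebra.le_away _ _ (Algebra.self_mem_adjoin_singleton R θ)⟩
  have hx (p : R[X]) : ((aeval x p : A) : K) = aeval θ p := (aeval_algHom_apply A.val x p).symm
  have hmap : P.HasMap x := by
    refine ⟨Subtype.ext ((hx _).trans (minpoly.aeval R θ)), ?_⟩
    refine .of_mul_eq_one ⟨_, Subalgebra.inv_mem_away _ hv⟩ (Subtype.ext ?_)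
    have : ((aeval x P.g : A) : K) = v := (hx _).trans hg
    simp [this, hv]
  have hlift (p : R[X]) : P.lift x hmap (aeval P.X p) = aeval x p := by
    rw [← aeval_algHom_apply, P.lift_X]
  refine ⟨⟨P, x, hmap, ?_, ?_⟩⟩
  · rw [injective_iff_map_eq_zero]
    intro z hz
    let P' : StandardEtalePresentation R P.Ring :=
      ⟨P, P.X, P.hasMap_X, by simpa [StandardEtalePair.lift_X_left] using Function.bijective_id⟩
    obtain ⟨p, n, hp⟩ := P'.exists_mul_aeval_x_g_pow_eq_aeval_x z
    have hp' : z * (aeval P.X P.g) ^ n = aeval P.X p := hp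
    have h0 : aeval x p = 0 := by rw [← hlift, ← hp', map_mul, hz, zero_mul]
    obtain ⟨c, rfl⟩ := hdvd p (by rw [← hx, h0]; rfl)
    have h1 : aeval P.X (minpoly R θ) = 0 := P.hasMap_X.1
    rw [map_mul, h1, zero_mul] at hp'
    exact (P.hasMap_X.2.pow n).mul_left_eq_zero.1 hp'
  · rintro ⟨y, n, hn⟩
    obtain ⟨p, hp⟩ := key _ hn
    obtain ⟨u, hu⟩ := P.hasMap_X.2
    refine ⟨aeval P.X p * (↑u⁻¹) ^ n, ?_⟩
    have h1 : P.lift x hmap (↑u⁻¹) * aeval x P.g = 1 := by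
      rw [← hlift, ← map_mul, ← hu]; simp
    have h2 := congrArg (Subtype.val : A → K) h1
    have h3 : ((aeval x P.g : A) : K) = v := (hx _).trans hg
    simp only [MulMemClass.coe_mul, OneMemClass.coe_one, h3] at h2
    apply Subtype.ext
    rw [map_mul, hlift, map_pow]
    simp only [MulMemClass.coe_mul, SubmonoidClass.coe_pow, hx, hp, eq_inv_of_mul_eq_one_left h2]
    rw [inv_pow, mul_inv_cancel_right₀ (pow_ne_zero n hv)]
end

section
variable {k R K : Type*} [Field k] [CommRing R] [Field K] [Algebra k R] [Algebra R K] [Algebra k K]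
  [IsScalarTower k R K]

theorem Subalgebra.coe_algebraMap_tower (B : Subalgebra R K) (c : k) :
    ((algebraMap k B c : B) : K) = algebraMap k K c :=
  (IsScalarTower.algebraMap_apply k B K c).symm

theorem Subalgebra.exists_algHom_restrict {B : Subalgebra R K} {σ : K →ₐ[k] K}
    (hσ : ∀ x ∈ B, σ x ∈ B) : ∃ f : B →ₐ[k] B, ∀ x, (f x : K) = σ (x : K) :=
  ⟨{ toFun x := ⟨σ (x : K), hσ x x.2⟩
     map_one' := Subtype.ext (map_one σ)
     map_mul' x y := Subtype.ext (map_mul σ (x : K) y)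
     map_zero' := Subtype.ext (map_zero σ)
     map_add' x y := Subtype.ext (map_add σ (x : K) y)
     commutes' r := Subtype.ext (by
      change σ ((algebraMap k B r : B) : K) = (algebraMap k B r : B)
      rw [B.coe_algebraMap_tower, AlgHom.commutes]) }, fun _ ↦ rfl⟩

theorem Subalgebra.apply_ne_zero_of_inv_mem_away {B : Subalgebra R K} {w : B} (Q : B →ₐ[k] k)
    (hQ : Q w ≠ 0) {x : B} (hx : (x : K) ≠ 0) (hx' : (x : K)⁻¹ ∈ B.away w) : Q x ≠ 0 := by
  obtain ⟨n, hn⟩ := hx'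
  have h : w ^ n = x * ⟨_, hn⟩ := Subtype.ext (by simp [hx])
  intro h0
  have := congrArg Q h
  rw [map_mul, h0, zero_mul, map_pow] at this
  exact pow_ne_zero n hQ this

variable {Γ H : Subgroup (K ≃ₐ[k] K)} [Fintype H] {B : Subalgebra R K} {θ : B}

theorem eq_of_algHom_apply_eq
    (hdiff : ∀ σ ∈ Γ, ∀ τ ∈ Γ, σ ≠ τ → σ θ ≠ τ θ ∧ (σ (θ : K) - τ θ)⁻¹ ∈ B)
    (P : B →ₐ[k] k) {σ τ : K ≃ₐ[k] K} (hσ : σ ∈ Γ) (hτ : τ ∈ Γ) {x y : B} (hx : (x : K) = σ θ)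
    (hy : (y : K) = τ θ) (h : P x = P y) : σ = τ := by
  by_contra hne
  obtain ⟨h1, h2⟩ := hdiff σ hσ τ hτ hne
  have h3 : (x - y) * ⟨_, h2⟩ = 1 := Subtype.ext (by
    simp only [MulMemClass.coe_mul, AddSubgroupClass.coe_sub, hx, hy]
    exact mul_inv_cancel₀ (sub_ne_zero.2 h1))
  have := congrArg P h3
  rw [map_mul, map_sub, h, sub_self, zero_mul, map_one] at this
  exact zero_ne_one this

theorem algHom_apply_prod_eq_zero (hB : ∀ σ ∈ Γ, ∀ x ∈ B, σ x ∈ B) (hH : H ≤ Γ) {c : k} {w : B}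
    (hw : (w : K) = ∏ h : H, (h.1 θ - algebraMap k K c)) {σ : K ≃ₐ[k] K} (hσ : σ ∈ Γ)
    (P : B →ₐ[k] k) {x : B} (hx : (x : K) = σ w) (h0 : P x = 0) :
    ∃ h ∈ H, ∃ y : B, (y : K) = (σ * h) θ ∧ P y = c := by
  have hy (h : H) : (σ * h) θ ∈ B := hB _ (Γ.mul_mem hσ (hH h.2)) _ θ.2
  have h1 : x = ∏ h : H, (⟨_, hy h⟩ - algebraMap k B c) := Subtype.ext (by
    rw [hx, hw, map_prod]
    refine .trans (Finset.prod_congr rfl fun h _ ↦ ?_) (map_prod B.val _ _).symm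
    rw [map_sub, map_sub, AlgEquiv.commutes]
    exact congrArg _ (B.coe_algebraMap_tower c).symm)
  rw [h1, map_prod, Finset.prod_eq_zero_iff] at h0
  obtain ⟨h, -, h2⟩ := h0
  refine ⟨h, h.2, ⟨_, hy h⟩, rfl, ?_⟩
  rwa [map_sub, AlgHom.commutes, sub_eq_zero] at h2

theorem exists_algHom_apply_prod_ne_zero (hB : ∀ σ ∈ Γ, ∀ x ∈ B, σ x ∈ B) (hH : H < Γ)
    (hdiff : ∀ σ ∈ Γ, ∀ τ ∈ Γ, σ ≠ τ → σ θ ≠ τ θ ∧ (σ (θ : K) - τ θ)⁻¹ ∈ B) {c : k} {w : B}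
    (hw : (w : K) = ∏ h : H, (h.1 θ - algebraMap k K c)) (P : B →ₐ[k] k) :
    ∃ Q : B →ₐ[k] k, (∀ x : B, (∀ σ ∈ Γ, σ x = x) → Q x = P x) ∧ Q w ≠ 0 := by
  by_contra! hcon
  refine hH.not_ge fun σ hσ ↦ ?_
  have key (σ : K ≃ₐ[k] K) (hσ : σ ∈ Γ) : ∃ h ∈ H, ∃ y : B, (y : K) = (σ * h) θ ∧ P y = c := by
    obtain ⟨f, hf⟩ := Subalgebra.exists_algHom_restrict (σ := (σ : K →ₐ[k] K)) (hB σ hσ)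
    refine algHom_apply_prod_eq_zero hB hH.le hw hσ P (hf w) (hcon (P.comp f) fun x hx ↦ ?_)
    exact congrArg P (Subtype.ext ((hf x).trans (hx σ hσ)))
  obtain ⟨h, hh, y, hy, hyc⟩ := key σ hσ
  obtain ⟨h', hh', y', hy', hyc'⟩ := key 1 Γ.one_mem
  have := eq_of_algHom_apply_eq hdiff P (Γ.mul_mem hσ (hH.le hh))
    (Γ.mul_mem Γ.one_mem (hH.le hh')) hy hy' (hyc.trans hyc'.symm)
  rw [one_mul] at this
  rw [eq_mul_inv_of_mul_eq this]
  exact H.mul_mem hh' (H.inv_mem hh)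

theorem mem_of_forall_apply_mem_away (hB : ∀ σ ∈ Γ, ∀ x ∈ B, σ x ∈ B) (hH : H ≤ Γ)
    (hdiff : ∀ σ ∈ Γ, ∀ τ ∈ Γ, σ ≠ τ → σ θ ≠ τ θ ∧ (σ (θ : K) - τ θ)⁻¹ ∈ B) {w : B}
    (P : B →ₐ[k] k) (hw : (w : K) = ∏ h : H, (h.1 θ - algebraMap k K (P θ))) (hw0 : (w : K) ≠ 0)
    {σ : K ≃ₐ[k] K} (hσ : σ ∈ Γ) (hσA : ∀ x ∈ B.away w, σ x ∈ B.away w) : σ ∈ H := by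
  classical
  have hcK (c : k) : algebraMap k K c ∈ B := (algebraMap k B c).2
  have hinv : ((θ : K) - algebraMap k K (P θ))⁻¹ ∈ B.away w := by
    refine ⟨1, ?_⟩
    rw [pow_one]
    have h1 := Finset.mul_prod_erase Finset.univ
      (fun h : H ↦ h.1 θ - algebraMap k K (P θ)) (Finset.mem_univ 1)
    rw [← hw] at h1
    have h2 : (θ : K) - algebraMap k K (P θ) ≠ 0 := by
      intro h
      apply hw0
      rw [← h1]
      simp [h]
    rw [← h1]
    simp only [OneMemClass.coe_one, AlgEquiv.one_apply]
    rw [inv_mul_cancel_left₀ h2]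
    exact prod_mem fun h _ ↦ sub_mem (hB _ (hH h.2) _ θ.2) (hcK _)
  have hσinv := hσA _ hinv
  rw [map_inv₀, map_sub, AlgEquiv.commutes] at hσinv
  have hτ := Γ.inv_mem hσ
  obtain ⟨f, hf⟩ := Subalgebra.exists_algHom_restrict (σ := ((σ⁻¹ : K ≃ₐ[k] K) : K →ₐ[k] K)) (hB _ hτ)
  let x : B := ⟨_, hB σ hσ θ θ.2⟩ - algebraMap k B (P θ)
  have hx : P.comp f x = 0 := by
    have : f ⟨_, hB σ hσ θ θ.2⟩ = θ := Subtype.ext (by rw [hf]; exact σ.symm_apply_apply θ)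
    simp [x, this]
  have hPw : P.comp f w = 0 := by
    by_contra hne
    refine Subalgebra.apply_ne_zero_of_inv_mem_away (P.comp f) hne (x := x) ?_ hσinv hx
    intro h0
    apply hw0
    have h1 : σ ((θ : K) - algebraMap k K (P θ)) = 0 := by
      rw [← h0, map_sub, AlgEquiv.commutes]
      exact congrArg _ (B.coe_algebraMap_tower _).symm
    rw [hw, Finset.prod_eq_zero_iff]
    exact ⟨1, Finset.mem_univ _, σ.map_eq_zero_iff.1 h1⟩
  obtain ⟨h, hh, y, hy, hyc⟩ := algHom_apply_prod_eq_zero hB hH hw hτ P (hf w) hPw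
  have := eq_of_algHom_apply_eq hdiff P (Γ.mul_mem hτ (hH hh)) Γ.one_mem hy (y := θ) (by simp) hyc
  rw [inv_mul_eq_one.1 this]
  exact hh

omit [Algebra k R] [IsScalarTower k R K] in
theorem apply_mem_away_iff (hB : ∀ σ ∈ Γ, ∀ x ∈ B, σ x ∈ B) (hH : H ≤ Γ) {c : k} {w : B}
    (hw : (w : K) = ∏ h : H, (h.1 θ - algebraMap k K c)) {σ : K ≃ₐ[k] K} (hσ : σ ∈ H) (x : K) :
    σ x ∈ B.away w ↔ x ∈ B.away w := by
  have key (σ : K ≃ₐ[k] K) (hσ : σ ∈ H) (x : K) (hx : x ∈ B.away w) : σ x ∈ B.away w := by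
    have h1 : σ w = w := by
      rw [hw, map_prod]
      refine Fintype.prod_equiv (Equiv.mulLeft (⟨σ, hσ⟩ : H)) _ _ fun h ↦ ?_
      rw [map_sub, AlgEquiv.commutes]
      rfl
    obtain ⟨n, hn⟩ := hx
    refine ⟨n, ?_⟩
    have := hB σ (hH hσ) _ hn
    rwa [map_mul, map_pow, h1] at this
  refine ⟨fun h ↦ ?_, key σ hσ x⟩
  have := key σ⁻¹ (H.inv_mem hσ) _ h
  rwa [show σ⁻¹ (σ x) = x from σ.symm_apply_apply x] at this

theorem Subalgebra.nonempty_mulEquiv_subgroup (A : Subalgebra R K) [IsFractionRing A K]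
    {H : Subgroup (K ≃ₐ[k] K)} (hA : ∀ φ : K ≃ₐ[k] K, φ ∈ H ↔ ∀ x, φ x ∈ A ↔ x ∈ A) :
    Nonempty ((A ≃ₐ[k] A) ≃* H) := by
  let Φ : (A ≃ₐ[k] A) →* (K ≃ₐ[k] K) := IsFractionRing.fieldEquivOfAlgEquivHom k K
  have hΦ (f : A ≃ₐ[k] A) (x : A) : Φ f x = f x :=
    IsFractionRing.fieldEquivOfAlgEquiv_algebraMap k K K f x
  have hinj : Function.Injective Φ := IsFractionRing.fieldEquivOfAlgEquivHom_injective k A k K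
  have hrange : Φ.range = H := by
    ext φ
    rw [hA, MonoidHom.mem_range]
    constructor
    · rintro ⟨f, rfl⟩ x
      have key (f : A ≃ₐ[k] A) (x : K) (hx : x ∈ A) : Φ f x ∈ A := hΦ f ⟨x, hx⟩ ▸ (f ⟨x, hx⟩).2
      refine ⟨fun h ↦ ?_, key f x⟩
      have := key f⁻¹ _ h
      rwa [map_inv, show (Φ f)⁻¹ (Φ f x) = x from (Φ f).symm_apply_apply x] at this
    · intro h
      obtain ⟨f, hf⟩ := A.exists_algHom_restrict (σ := (φ : K →ₐ[k] K)) fun x hx ↦ (h x).2 hx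
      have hbij : Function.Bijective f := by
        refine ⟨fun x y hxy ↦ Subtype.ext (φ.injective ?_), fun y ↦ ?_⟩
        · exact (hf x).symm.trans ((congrArg Subtype.val hxy).trans (hf y))
        · have hy := φ.apply_symm_apply (y : K)
          exact ⟨⟨φ.symm y, (h _).1 (hy.symm ▸ y.2 : φ (φ.symm (y : K)) ∈ A)⟩, Subtype.ext ((hf _).trans hy)⟩
      refine ⟨.ofBijective f hbij, AlgEquiv.ext fun x ↦ ?_⟩
      obtain ⟨a, b, -, rfl⟩ := IsFractionRing.div_surjective A x
      rw [map_div₀, map_div₀]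
      exact congrArg₂ (· / ·) ((hΦ _ a).trans (hf a)) ((hΦ _ b).trans (hf b))
  exact ⟨(MonoidHom.ofInjective hinj).trans (MulEquiv.subgroupCongr hrange)⟩
end

open scoped IntermediateField in
theorem exists_integral_generator (R F K : Type*) [CommRing R] [IsDomain R] [Field F] [Field K]
    [Algebra R F] [IsFractionRing R F] [Algebra R K] [Algebra F K] [IsScalarTower R F K]
    [FiniteDimensional F K] [Algebra.IsSeparable F K] :
    ∃ θ : K, IsIntegral R θ ∧ ∀ x : K, ∃ r : R, r ≠ 0 ∧
      x * algebraMap R K r ∈ Algebra.adjoin R {θ} := by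
  obtain ⟨α, hα⟩ := Field.exists_primitive_element F K
  have : Algebra.IsAlgebraic R F := IsLocalization.isAlgebraic F (nonZeroDivisors R)
  have : Algebra.IsAlgebraic R K := Algebra.IsAlgebraic.trans R F K
  obtain ⟨y, hy0, hy⟩ := (Algebra.IsAlgebraic.isAlgebraic (R := R) α).exists_integral_multiple
  refine ⟨y • α, hy, fun x ↦ ?_⟩
  have hF : algebraMap R F y ≠ 0 := (map_ne_zero_iff _ (IsFractionRing.injective R F)).2 hy0
  have hα' : F⟮y • α⟯ = ⊤ := by
    rw [eq_top_iff, ← hα, IntermediateField.adjoin_simple_le_iff]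
    have : α = (algebraMap R F y)⁻¹ • (y • α) := by
      rw [← algebraMap_smul F y α, inv_smul_smul₀ hF]
    nth_rewrite 2 [this]
    exact IntermediateField.smul_mem _ (IntermediateField.mem_adjoin_simple_self F _)
  have hx : x ∈ F⟮y • α⟯.toSubalgebra := by rw [hα']; trivial
  rw [IntermediateField.adjoin_simple_toSubalgebra_of_isAlgebraic (Algebra.IsAlgebraic.isAlgebraic _),
    Algebra.adjoin_singleton_eq_range_aeval] at hx
  obtain ⟨p, rfl⟩ := hx
  obtain ⟨b, hb0, hb⟩ := IsLocalization.integerNormalization_spec (nonZeroDivisors R) p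
  refine ⟨b, nonZeroDivisors.ne_zero hb0, ?_⟩
  rw [Algebra.adjoin_singleton_eq_range_aeval]
  refine ⟨IsLocalization.integerNormalization (nonZeroDivisors R) p, ?_⟩
  have := aeval_map_algebraMap F (y • α) (IsLocalization.integerNormalization (nonZeroDivisors R) p)
  refine this.symm.trans ?_
  rw [hb, AlgHom.map_smul_of_tower, Algebra.smul_def, mul_comm]
  rfl

section
variable {k K : Type*} [Field k] [IsAlgClosed k] [Field K] [Algebra k K] [Algebra k[X] K]
  [IsScalarTower k k[X] K]

theorem Polynomial.exists_dvd_prod_X_sub_C_pow [DecidableEq k] {q : k[X]} (hq : q ≠ 0)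
    {T : Finset k} (hT : q.roots.toFinset ⊆ T) : ∃ n, q ∣ (∏ a ∈ T, (X - C a)) ^ n := by
  obtain ⟨n, hn⟩ := q.roots.le_smul_dedup
  refine ⟨n, ?_⟩
  have h1 := (IsAlgClosed.splits q).eq_prod_roots
  have h2 := Multiset.prod_dvd_prod_of_le (Multiset.map_le_map (f := fun a ↦ X - C a) hn)
  rw [Multiset.map_nsmul, Multiset.prod_nsmul] at h2
  have h3 : ((q.roots.dedup).map (fun a ↦ X - C a)).prod ∣ ∏ a ∈ T, (X - C a) :=
    Finset.prod_dvd_prod_of_subset q.roots.toFinset T _ hT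
  rw [h1]
  exact ((isUnit_C.2 (isUnit_iff_ne_zero.2 (leadingCoeff_ne_zero.2 hq))).mul_left_dvd).2
    (h2.trans (pow_dvd_pow_of_dvd h3 n))

omit [Algebra k K] [IsScalarTower k k[X] K] in
theorem Subalgebra.exists_finset_forall_mem_away (S : Subalgebra k[X] K)
    (hS : ∀ x : K, ∃ r : k[X], r ≠ 0 ∧ x * algebraMap k[X] K r ∈ S) (E : Finset K) :
    ∃ T₀ : Finset k, ∀ T, T₀ ⊆ T → ∀ x ∈ E,
      x ∈ S.away (algebraMap k[X] S (∏ a ∈ T, (X - C a))) := by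
  classical
  choose r hr0 hr using hS
  refine ⟨E.biUnion fun x ↦ (r x).roots.toFinset, fun T hT x hx ↦ ?_⟩
  obtain ⟨n, c, hc⟩ := Polynomial.exists_dvd_prod_X_sub_C_pow (hr0 x)
    ((Finset.subset_biUnion_of_mem (fun x ↦ (r x).roots.toFinset) hx).trans hT)
  refine ⟨n, ?_⟩
  have := S.mul_mem (hr x) (S.algebraMap_mem c)
  rwa [mul_assoc, ← map_mul, ← hc, map_pow] at this

omit [IsAlgClosed k] [Algebra k K] [IsScalarTower k k[X] K] in
theorem Subalgebra.isFractionRing_of_forall_exists [FaithfulSMul k[X] K] (S A : Subalgebra k[X] K)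
    (hS : ∀ x : K, ∃ r : k[X], r ≠ 0 ∧ x * algebraMap k[X] K r ∈ S) (hA : S ≤ A) :
    IsFractionRing A K := by
  refine .of_field A K fun z ↦ ?_
  obtain ⟨r, hr0, hr⟩ := hS z
  have : algebraMap k[X] K r ≠ 0 :=
    (map_ne_zero_iff _ (FaithfulSMul.algebraMap_injective k[X] K)).2 hr0
  exact ⟨⟨_, hA hr⟩, algebraMap k[X] A r, (mul_div_cancel_right₀ z this).symm⟩

theorem Subalgebra.exists_algHom_away [FaithfulSMul k[X] K] (S : Subalgebra k[X] K)
    [Algebra.FiniteType k S] [Algebra.IsIntegral k[X] S] (q : k[X]) (hq : q ≠ 0) (b : k)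
    (hb : q.eval b ≠ 0) :
    ∃ P : S.away (algebraMap k[X] S q) →ₐ[k] k, P (algebraMap k[X] _ X) = b := by
  have hmax : (Ideal.span {X - C b}).IsMaximal := PrincipalIdealRing.isMaximal_of_irreducible
    (irreducible_X_sub_C b)
  have hinj : Function.Injective (algebraMap k[X] S) :=
    .of_comp (f := Subtype.val) (FaithfulSMul.algebraMap_injective k[X] K)
  obtain ⟨M, hM, hMb⟩ := Ideal.exists_ideal_over_maximal_of_isIntegral (S := S)
    (Ideal.span {X - C b}) (by rw [(RingHom.injective_iff_ker_eq_bot _).1 hinj]; exact bot_le)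
  let := Ideal.Quotient.field M
  have : Module.Finite k (S ⧸ M) := finite_of_finite_type_of_isJacobsonRing k (S ⧸ M)
  let e : k ≃ₐ[k] S ⧸ M := .ofBijective (Algebra.ofId k (S ⧸ M))
    IsAlgClosed.algebraMap_bijective_of_isIntegral
  let P₀ : S →ₐ[k] k := (e.symm : S ⧸ M →ₐ[k] k).comp (Ideal.Quotient.mkₐ k M)
  have hP₀ (p : k[X]) : P₀ (algebraMap k[X] S p) = p.eval b := by
    have h1 : P₀ (algebraMap k[X] S X) = b := by
      have : algebraMap k[X] S (X - C b) ∈ M := by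
        rw [← Ideal.mem_comap, hMb]; exact Ideal.mem_span_singleton_self _
      have h2 : P₀ (algebraMap k[X] S (X - C b)) = 0 := by
        simp only [P₀, AlgHom.comp_apply, Ideal.Quotient.mkₐ_eq_mk,
          Ideal.Quotient.eq_zero_iff_mem.2 this, map_zero]
      rw [map_sub, map_sub, sub_eq_zero] at h2
      rw [h2]
      exact (congrArg P₀ (IsScalarTower.algebraMap_apply k k[X] S b).symm).trans (P₀.commutes b)
    have h2 : P₀.comp (IsScalarTower.toAlgHom k k[X] S) = aeval b := by
      ext; simpa using h1
    simpa [aeval_def] using DFunLike.congr_fun h2 p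
  let : Algebra S (S.away (algebraMap k[X] S q)) :=
    (Subalgebra.inclusion (S.le_away (algebraMap k[X] S q))).toAlgebra
  have : IsScalarTower k S (S.away (algebraMap k[X] S q)) := .of_algebraMap_eq' rfl
  have := S.isLocalization_away (v := algebraMap k[X] S q)
    ((map_ne_zero_iff _ (FaithfulSMul.algebraMap_injective k[X] K)).2 hq)
  refine ⟨IsLocalization.liftAlgHom (M := .powers (algebraMap k[X] S q)) (f := P₀) ?_, ?_⟩
  · rintro ⟨_, n, rfl⟩
    simp [hP₀, hb]
  · refine (IsLocalization.lift_eq _ (algebraMap k[X] S X)).trans ?_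
    simpa using hP₀ X
end

section
variable {k : Type*} [Field k]

open scoped IntermediateField in
theorem ratFunc_exists_coeffs_of_adjoin_eq_top {r : RatFunc k} (hr : k⟮r⟯ = ⊤) :
    ∃ α β γ δ : k, α * δ - β * γ ≠ 0 ∧ r.num = C α * X + C β ∧ r.denom = C γ * X + C δ := by
  have h := RatFunc.finrank_eq_max_natDegree r
  rw [hr, IntermediateField.finrank_top] at h
  obtain ⟨α, β, hn⟩ := exists_eq_X_add_C_of_natDegree_le_one (p := r.num) (by omega)
  obtain ⟨γ, δ, hd⟩ := exists_eq_X_add_C_of_natDegree_le_one (p := r.denom) (by omega)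
  refine ⟨α, β, γ, δ, fun h0 ↦ ?_, hn, hd⟩
  by_cases hγ : γ = 0
  · subst hγ
    have hd0 := r.denom_ne_zero
    by_cases hα : α = 0
    · subst hα
      simp [hn, hd] at h
    · have : δ = 0 := by simpa [hα] using h0
      simp [hd, this] at hd0
  · have h1 : C γ * r.num = C α * r.denom := by
      rw [hn, hd]
      have := congrArg (C (R := k)) h0
      simp only [C_sub, C_mul, C_0] at this
      linear_combination -this
    have h2 : r.denom ∣ r.num := by
      rw [← ((isUnit_C.2 (isUnit_iff_ne_zero.2 hγ)).dvd_mul_left), h1]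
      exact dvd_mul_left _ _
    have h3 := natDegree_eq_zero_of_isUnit (r.isCoprime_num_denom.isUnit_of_dvd' h2 dvd_rfl)
    rw [hd, natDegree_linear hγ] at h3
    exact one_ne_zero h3

variable {K : Type*} [Field K] [Algebra k K] [Algebra (RatFunc k) K]
  [IsScalarTower k (RatFunc k) K] [Algebra k[X] K] [IsScalarTower k[X] (RatFunc k) K]

open scoped IntermediateField in
theorem algEquiv_exists_moebius_of_apply_mem_ratFunc (φ : K ≃ₐ[k] K) {r r' : RatFunc k}
    (hr : φ (algebraMap k[X] K X) = algebraMap (RatFunc k) K r)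
    (hr' : φ.symm (algebraMap k[X] K X) = algebraMap (RatFunc k) K r') :
    ∃ α β γ δ : k, α * δ - β * γ ≠ 0 ∧
      φ (algebraMap k[X] K X) * algebraMap k[X] K (C γ * X + C δ) =
        algebraMap k[X] K (C α * X + C β) := by
  rw [IsScalarTower.algebraMap_apply k[X] (RatFunc k) K, RatFunc.algebraMap_X] at hr hr'
  let ι := IsScalarTower.toAlgHom k (RatFunc k) K
  let ψ : RatFunc k →ₐ[k] K := (φ : K →ₐ[k] K).comp ι
  have h1 : ι RatFunc.X ∈ k⟮r⟯.map ι := by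
    have h2 : ψ r' ∈ (⊤ : IntermediateField k (RatFunc k)).map ψ := ⟨r', trivial, rfl⟩
    rw [← RatFunc.adjoin_X, IntermediateField.adjoin_map, Set.image_singleton] at h2
    have h3 : ψ RatFunc.X = ι r := hr
    have h4 : ψ r' = ι RatFunc.X := by
      change φ (algebraMap (RatFunc k) K r') = _
      rw [← hr', AlgEquiv.apply_symm_apply]
      rfl
    rwa [IntermediateField.adjoin_map, Set.image_singleton, ← h3, ← h4]
  have h5 : k⟮r⟯ = ⊤ := by
    obtain ⟨x, hx, hx'⟩ := h1
    rw [ι.injective hx'] at hx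
    rw [eq_top_iff, ← RatFunc.adjoin_X, IntermediateField.adjoin_simple_le_iff]
    exact hx
  obtain ⟨α, β, γ, δ, hdet, hn, hd⟩ := ratFunc_exists_coeffs_of_adjoin_eq_top h5
  refine ⟨α, β, γ, δ, hdet, ?_⟩
  rw [← hn, ← hd]
  simp only [IsScalarTower.algebraMap_apply k[X] (RatFunc k) K, RatFunc.algebraMap_X]
  rw [hr, ← map_mul]
  congr 1
  have := r.num_div_denom
  rwa [div_eq_iff (RatFunc.algebraMap_ne_zero r.denom_ne_zero), eq_comm] at this

end

section
variable {k : Type*} [Field k] {K : Type*} [Field K] [Algebra k K] [Algebra k[X] K]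
  [IsScalarTower k k[X] K]

theorem Subalgebra.apply_X_eq_of_moebius [FaithfulSMul k[X] K] {B : Subalgebra k[X] K} {w : B}
    {T : Finset k}
    (hT : ∀ α β γ δ : k, α * δ - β * γ ≠ 0 →
      (∀ a ∈ T, α - γ * a ≠ 0 → (δ * a - β) / (α - γ * a) ∈ T) → γ = 0 ∧ β = 0 ∧ α = δ)
    (hTB : ∀ a ∈ T, (algebraMap k[X] K (X - C a))⁻¹ ∈ B.away w)
    (hpt : ∀ b, b ∉ T → ∃ Q : B →ₐ[k] k, Q (algebraMap k[X] B X) = b ∧ Q w ≠ 0)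
    {φ : K ≃ₐ[k] K} (hφ : ∀ x ∈ B.away w, φ x ∈ B.away w) {α β γ δ : k}
    (hdet : α * δ - β * γ ≠ 0)
    (h : φ (algebraMap k[X] K X) * algebraMap k[X] K (C γ * X + C δ) =
        algebraMap k[X] K (C α * X + C β)) : φ (algebraMap k[X] K X) = algebraMap k[X] K X := by
  have hC (c : k) : algebraMap k[X] K (C c) = algebraMap k K c :=
    (IsScalarTower.algebraMap_apply k k[X] K c).symm
  obtain ⟨rfl, rfl, rfl⟩ := hT α β γ δ hdet fun a ha hne ↦ by
    by_contra hb
    obtain ⟨Q, hQ, hQw⟩ := hpt _ hb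
    obtain ⟨n, hn⟩ := hφ _ (hTB a ha)
    set b := (δ * a - β) / (α - γ * a) with hbdef
    have hbmul : b * (α - γ * a) = δ * a - β := div_mul_cancel₀ _ hne
    have hne0 : φ (algebraMap k[X] K (X - C a)) ≠ 0 := by
      rw [map_ne_zero_iff _ φ.injective,
        map_ne_zero_iff _ (FaithfulSMul.algebraMap_injective k[X] K)]
      exact X_sub_C_ne_zero a
    have h1 : φ (algebraMap k[X] K (X - C a)) * algebraMap k[X] K (C γ * X + C δ) =
        algebraMap k[X] K (C (α - γ * a) * (X - C b)) := by
      have h2 : (C (α - γ * a) * (X - C b) : k[X]) =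
          C α * X + C β - C a * (C γ * X + C δ) := by
        have := congrArg (C (R := k)) hbmul
        simp only [C_sub, C_mul] at this ⊢
        linear_combination -this
      rw [h2, map_sub, map_sub, sub_mul, map_sub, map_mul _ (C a), h, hC, AlgEquiv.commutes]
    have h3 : algebraMap k[X] B (C γ * X + C δ) * w ^ n =
        algebraMap k[X] B (C (α - γ * a) * (X - C b)) * ⟨_, hn⟩ := Subtype.ext (by
      change algebraMap k[X] K (C γ * X + C δ) * (w : K) ^ n =
        algebraMap k[X] K (C (α - γ * a) * (X - C b)) * (_ * (w : K) ^ n)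
      rw [← h1, map_inv₀]
      field_simp)
    have hQp (p : k[X]) : Q (algebraMap k[X] B p) = p.eval b := by
      have h4 : Q.comp (IsScalarTower.toAlgHom k k[X] B) = aeval b := by
        ext; simpa using hQ
      simpa [aeval_def] using DFunLike.congr_fun h4 p
    have h5 := congrArg Q h3
    simp only [map_mul, hQp, map_pow] at h5
    have h6 : γ * b + δ = 0 := by simpa [hQw] using h5
    apply hdet
    linear_combination (α - γ * a) * h6 - γ * hbmul
  have hα : algebraMap k[X] K (C α) ≠ 0 := by
    rw [hC, _root_.map_ne_zero]
    rintro rfl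
    simp at hdet
  simp only [C_0, zero_mul, zero_add, add_zero, map_mul] at h
  rw [mul_comm] at h
  exact mul_left_cancel₀ hα h
end

theorem ringKrullDim_eq_one_of_dimensionLEOne {R : Type*} [CommRing R] [IsDomain R]
    [Ring.DimensionLEOne R] (h : ¬ IsField R) : ringKrullDim R = 1 := by
  have h0 : ¬ ringKrullDim R ≤ 0 := fun h0 ↦ by
    have : Ring.KrullDimLE 0 R := Ring.krullDimLE_iff.mpr h0
    exact h Ring.KrullDimLE.isField_of_isDomain
  exact le_antisymm (Ring.krullDimLE_iff.1 inferInstance) (Order.succ_le_of_lt (lt_of_not_ge h0))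

theorem Subalgebra.apply_mem_away_of_apply_mem {R K : Type*} [CommRing R] [Field K] [Algebra R K]
    (σ : K →ₐ[R] K) {θ : K} {q : R} (hq : algebraMap R K q ≠ 0)
    (h : σ θ ∈ (Algebra.adjoin R {θ}).away (algebraMap R _ q)) :
    ∀ x ∈ (Algebra.adjoin R {θ}).away (algebraMap R _ q),
      σ x ∈ (Algebra.adjoin R {θ}).away (algebraMap R _ q) := by
  set A := (Algebra.adjoin R {θ}).away (algebraMap R _ q) with hA
  have h1 : Algebra.adjoin R {θ} ≤ A.comap σ := Algebra.adjoin_le (by simpa using h)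
  rintro x ⟨n, hn⟩
  have h2 : σ (x * algebraMap R K q ^ n) ∈ A := h1 hn
  rw [map_mul, map_pow, AlgHom.commutes] at h2
  have h3 := A.mul_mem h2 (A.pow_mem (Subalgebra.inv_mem_away _ hq) n)
  convert h3 using 1
  change _ = _ * (algebraMap R K q)⁻¹ ^ n
  rw [inv_pow, mul_inv_cancel_right₀ (pow_ne_zero n hq)]

section
variable {k : Type*} [Field k] [IsAlgClosed k] [CharZero k] {K : Type*} [Field K] [Algebra k K]
  [Algebra (RatFunc k) K] [IsScalarTower k (RatFunc k) K] [Algebra k[X] K] [IsScalarTower k k[X] K]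
  [IsScalarTower k[X] (RatFunc k) K] [FiniteDimensional (RatFunc k) K]

omit [Algebra k K] [IsScalarTower k (RatFunc k) K] [IsScalarTower k k[X] K] in
theorem exists_galois_stable_model :
    ∃ θ : K, IsIntegral k[X] θ ∧
      (∀ x : K, ∃ r : k[X], r ≠ 0 ∧ x * algebraMap k[X] K r ∈ Algebra.adjoin k[X] {θ}) ∧
      ∃ T : Finset k,
        (∀ α β γ δ : k, α * δ - β * γ ≠ 0 →
          (∀ a ∈ T, α - γ * a ≠ 0 → (δ * a - β) / (α - γ * a) ∈ T) → γ = 0 ∧ β = 0 ∧ α = δ) ∧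
        aeval θ (derivative (minpoly k[X] θ)) ≠ 0 ∧
        (aeval θ (derivative (minpoly k[X] θ)))⁻¹ ∈
          (Algebra.adjoin k[X] {θ}).away (algebraMap k[X] _ (∏ a ∈ T, (X - C a))) ∧
        (∀ σ : K ≃ₐ[RatFunc k] K,
          σ θ ∈ (Algebra.adjoin k[X] {θ}).away (algebraMap k[X] _ (∏ a ∈ T, (X - C a)))) ∧
        ∀ σ τ : K ≃ₐ[RatFunc k] K, σ ≠ τ → σ θ ≠ τ θ ∧
          (σ θ - τ θ)⁻¹ ∈
            (Algebra.adjoin k[X] {θ}).away (algebraMap k[X] _ (∏ a ∈ T, (X - C a))) := by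
  classical
  obtain ⟨θ, hθ, hgen⟩ := exists_integral_generator k[X] (RatFunc k) K
  let E : Finset K := insert (aeval θ (derivative (minpoly k[X] θ)))⁻¹
    (Finset.univ.image (fun σ : K ≃ₐ[RatFunc k] K ↦ σ θ) ∪
      Finset.univ.image (fun p : (K ≃ₐ[RatFunc k] K) × (K ≃ₐ[RatFunc k] K) ↦ (p.1 θ - p.2 θ)⁻¹))
  obtain ⟨T₀, hT₀⟩ := Subalgebra.exists_finset_forall_mem_away _ hgen E
  obtain ⟨T, hT, hrigid⟩ := exists_finset_moebius_rigid T₀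
  have hE := hT₀ T hT
  refine ⟨θ, hθ, hgen, T, hrigid, ?_, hE _ (by simp [E]), fun σ ↦ hE _ (by simp [E]),
    fun σ τ hστ ↦ ⟨fun h ↦ hστ (AlgEquiv.ext fun x ↦ ?_), hE _ ?_⟩⟩
  · rw [← aeval_map_algebraMap (RatFunc k), ← derivative_map,
      ← minpoly.isIntegrallyClosed_eq_field_fractions' (RatFunc k) hθ]
    exact (Algebra.IsSeparable.isSeparable (RatFunc k) θ).aeval_derivative_ne_zero
      (minpoly.aeval _ _)
  · obtain ⟨r, hr0, hr⟩ := hgen x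
    have hle : Algebra.adjoin k[X] {θ} ≤ AlgHom.equalizer
        ((σ : K →ₐ[RatFunc k] K).restrictScalars k[X])
        ((τ : K →ₐ[RatFunc k] K).restrictScalars k[X]) :=
      Algebra.adjoin_le (by simpa using h)
    have hx : σ (x * algebraMap k[X] K r) = τ (x * algebraMap k[X] K r) := hle hr
    rw [IsScalarTower.algebraMap_apply k[X] (RatFunc k) K, map_mul, map_mul, σ.commutes,
      τ.commutes] at hx
    refine mul_right_cancel₀ ?_ hx
    rwa [_root_.map_ne_zero, map_ne_zero_iff _ (IsFractionRing.injective _ _)]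
  · refine Finset.mem_insert_of_mem (Finset.mem_union_right _ (Finset.mem_image.2 ?_))
    exact ⟨(σ, τ), Finset.mem_univ _, rfl⟩

theorem exists_smooth_subalgebra_aut_equiv (H : Subgroup (K ≃ₐ[k] K))
    (hH : H < (AlgEquiv.restrictScalarsHom k : (K ≃ₐ[RatFunc k] K) →* (K ≃ₐ[k] K)).range)
    (hφ : ∀ φ : K ≃ₐ[k] K, ∃ r : RatFunc k,
      φ (algebraMap (RatFunc k) K RatFunc.X) = algebraMap (RatFunc k) K r) :
    ∃ A : Subalgebra k[X] K, Algebra.Smooth k A ∧ ringKrullDim A = 1 ∧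
      Nonempty ((A ≃ₐ[k] A) ≃* H) := by
  classical
  have hsX : algebraMap k[X] K X = algebraMap (RatFunc k) K RatFunc.X := by
    rw [IsScalarTower.algebraMap_apply k[X] (RatFunc k) K, RatFunc.algebraMap_X]
  have hinj : Function.Injective (algebraMap k[X] K) := by
    rw [IsScalarTower.algebraMap_eq k[X] (RatFunc k) K]
    exact (algebraMap (RatFunc k) K).injective.comp (IsFractionRing.injective _ _)
  have : FaithfulSMul k[X] K := (faithfulSMul_iff_algebraMap_injective _ _).2 hinj
  obtain ⟨θ, hθ, hgen, T, hrigid, hd0, hd, hσθ, hdiff'⟩ := exists_galois_stable_model (k := k) (K := K)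
  set S := Algebra.adjoin k[X] {θ} with hS
  set q : k[X] := ∏ a ∈ T, (X - C a) with hq
  have hq0 : q ≠ 0 := Finset.prod_ne_zero_iff.2 fun a _ ↦ X_sub_C_ne_zero a
  have hqK : algebraMap k[X] K q ≠ 0 := (map_ne_zero_iff _ hinj).2 hq0
  have : Algebra.IsIntegral k[X] S := Algebra.IsIntegral.adjoin (by simpa using hθ)
  have : Algebra.FiniteType k[X] S := S.fg_iff_finiteType.1 ⟨{θ}, by simp [hS]⟩
  have : Algebra.FiniteType k S := Algebra.FiniteType.trans (S := k[X]) inferInstance inferInstance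
  set B := S.away (algebraMap k[X] S q) with hB_def
  set Γ := (AlgEquiv.restrictScalarsHom k : (K ≃ₐ[RatFunc k] K) →* (K ≃ₐ[k] K)).range with hΓ
  have : Finite Γ := Set.finite_range _ |>.to_subtype
  have : Finite H := .of_injective _ (Subgroup.inclusion_injective hH.le)
  have := Fintype.ofFinite H
  have hB : ∀ σ ∈ Γ, ∀ x ∈ B, σ x ∈ B := by
    rintro _ ⟨σ, rfl⟩
    exact Subalgebra.apply_mem_away_of_apply_mem
      ((σ : K →ₐ[RatFunc k] K).restrictScalars k[X]) hqK (hσθ σ)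
  have hpt (b : k) (hb : b ∉ T) : ∃ P : B →ₐ[k] k, P (algebraMap k[X] B X) = b := by
    refine S.exists_algHom_away q hq0 b ?_
    rw [hq, eval_prod, Finset.prod_ne_zero_iff]
    intro a ha h
    rw [eval_sub, eval_X, eval_C, sub_eq_zero] at h
    exact hb (h ▸ ha)
  have hΓX (σ : K ≃ₐ[k] K) (hσ : σ ∈ Γ) : σ (algebraMap k[X] K X) = algebraMap k[X] K X := by
    obtain ⟨σ, rfl⟩ := hσ
    rw [hsX]
    exact σ.commutes _
  have hXΓ (σ : K ≃ₐ[k] K) (hσ : σ (algebraMap k[X] K X) = algebraMap k[X] K X) : σ ∈ Γ := by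
    rw [hsX] at hσ
    exact ⟨.ofRingEquiv (f := (σ : K ≃+* K)) (fun r ↦
      algEquiv_apply_algebraMap_ratFunc (φ := (σ : K →ₐ[k] K)) hσ r), rfl⟩
  let θ' : B := ⟨θ, S.le_away _ (Algebra.self_mem_adjoin_singleton _ θ)⟩
  have hdiff : ∀ σ ∈ Γ, ∀ τ ∈ Γ, σ ≠ τ →
      σ θ' ≠ τ θ' ∧ (σ (θ' : K) - τ θ')⁻¹ ∈ B := by
    rintro _ ⟨σ, rfl⟩ _ ⟨τ, rfl⟩ h
    exact hdiff' σ τ fun h' ↦ h (by rw [h'])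
  obtain ⟨b₀, hb₀⟩ := Infinite.exists_notMem_finset T
  obtain ⟨P₀, -⟩ := hpt b₀ hb₀
  let w : B := ⟨∏ h : H, (h.1 θ' - algebraMap k K (P₀ θ')), prod_mem fun h _ ↦
    sub_mem (hB _ (hH.le h.2) _ θ'.2) (algebraMap k B (P₀ θ')).2⟩
  have hw : (w : K) = ∏ h : H, (h.1 θ' - algebraMap k K (P₀ θ')) := rfl
  have hpt' (b : k) (hb : b ∉ T) :
      ∃ Q : B →ₐ[k] k, Q (algebraMap k[X] B X) = b ∧ Q w ≠ 0 := by
    obtain ⟨P, hP⟩ := hpt b hb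
    obtain ⟨Q, hQ, hQw⟩ := exists_algHom_apply_prod_ne_zero hB hH hdiff hw P
    exact ⟨Q, (hQ _ hΓX).trans hP, hQw⟩
  obtain ⟨Q₀, hQ₀X, hQ₀⟩ := hpt' b₀ hb₀
  have hw0 : (w : K) ≠ 0 := fun h ↦ hQ₀ (by rw [show w = 0 from Subtype.ext h, map_zero])
  obtain ⟨N, hN⟩ := w.2
  let u : S := ⟨_, hN⟩
  have hA : B.away w = S.away (algebraMap k[X] S q * u) := S.away_away _ w u rfl
  have hv : ((algebraMap k[X] S q * u : S) : K) ≠ 0 :=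
    mul_ne_zero hqK (mul_ne_zero hw0 (pow_ne_zero N hqK))
  have hTB : ∀ a ∈ T, (algebraMap k[X] K (X - C a))⁻¹ ∈ B.away w := fun a ha ↦ by
    refine B.le_away w ⟨1, ?_⟩
    have h1 : algebraMap k[X] K (X - C a) ≠ 0 := (map_ne_zero_iff _ hinj).2 (X_sub_C_ne_zero a)
    rw [pow_one, hq, ← Finset.mul_prod_erase T _ ha, map_mul]
    change _ * (algebraMap k[X] K (X - C a) * algebraMap k[X] K _) ∈ S
    rw [inv_mul_cancel_left₀ h1]
    exact S.algebraMap_mem _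
  have hfrac : IsFractionRing (B.away w) K :=
    S.isFractionRing_of_forall_exists _ hgen ((S.le_away _).trans (B.le_away w))
  refine ⟨B.away w, ?_, ?_, (B.away w).nonempty_mulEquiv_subgroup fun φ ↦
    ⟨fun h ↦ apply_mem_away_iff hB hH.le hw h, fun h ↦ ?_⟩⟩
  · have : Algebra.IsStandardEtale k[X] (B.away w) :=
      hA ▸ Subalgebra.isStandardEtale_away hθ _ hv (hA ▸ B.le_away w hd) hd0
    have : Algebra.Smooth k k[X] := ⟨inferInstance, inferInstance⟩
    exact .comp k k[X] (B.away w)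
  · have : Ring.DimensionLEOne (B.away w) := hA ▸ S.dimensionLEOne_away _ hv
    refine ringKrullDim_eq_one_of_dimensionLEOne fun hf ↦ ?_
    have h1 : algebraMap k[X] K (X - C b₀) ≠ 0 := (map_ne_zero_iff _ hinj).2 (X_sub_C_ne_zero b₀)
    obtain ⟨y, hy⟩ := hf.mul_inv_cancel (a := algebraMap k[X] (B.away w) (X - C b₀))
      fun h ↦ h1 (congrArg Subtype.val h)
    have hy' : algebraMap k[X] K (X - C b₀) * y = 1 := congrArg Subtype.val hy
    refine Subalgebra.apply_ne_zero_of_inv_mem_away Q₀ hQ₀ (x := algebraMap k[X] B (X - C b₀)) h1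
      (eq_inv_of_mul_eq_one_right hy' ▸ y.2) ?_
    rw [map_sub, map_sub, hQ₀X, sub_eq_zero]
    exact (Q₀.commutes b₀).symm.trans
      (congrArg Q₀ (IsScalarTower.algebraMap_apply k k[X] B b₀))
  · obtain ⟨r, hr⟩ := hφ φ
    obtain ⟨r', hr'⟩ := hφ φ.symm
    rw [← hsX] at hr hr'
    obtain ⟨α, β, γ, δ, hdet, hmoeb⟩ := algEquiv_exists_moebius_of_apply_mem_ratFunc φ hr hr'
    have hφX := Subalgebra.apply_X_eq_of_moebius hrigid hTB hpt' (fun x ↦ (h x).2) hdet hmoeb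
    exact mem_of_forall_apply_mem_away hB hH.le hdiff P₀ hw hw0 (hXΓ φ hφX) fun x ↦ (h x).2
end

/-- For every finite group `G` there is a smooth affine curve `C` (given by its
coordinate ring `A`) over an algebraically closed field `k` of characteristic zero
such that `Aut(C) ≃ G`. -/
theorem exists_smooth_affine_curve_with_aut_group
    (k : Type) [Field k] [IsAlgClosed k] [CharZero k]
    (G : Type) [Group G] [Finite G] :
    ∃ (A : Type) (_ : CommRing A) (_ : Algebra k A),
      Algebra.FiniteType k A ∧ IsDomain A ∧ Algebra.Smooth k A ∧
      ringKrullDim A = 1 ∧ Nonempty ((A ≃ₐ[k] A) ≃* G) := by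
  obtain ⟨K, _, _, _, _, _, ρ, hρ, hρ', hφ⟩ := exists_functionField_of_finite_group k G
  let : Algebra k[X] K := ((algebraMap (RatFunc k) K).comp (algebraMap k[X] (RatFunc k))).toAlgebra
  have : IsScalarTower k[X] (RatFunc k) K := .of_algebraMap_eq' rfl
  have : IsScalarTower k k[X] K := .of_algebraMap_eq' <| by
    rw [IsScalarTower.algebraMap_eq k[X] (RatFunc k) K, RingHom.comp_assoc,
      ← IsScalarTower.algebraMap_eq k k[X] (RatFunc k), ← IsScalarTower.algebraMap_eq]
  let res : (K ≃ₐ[RatFunc k] K) →* (K ≃ₐ[k] K) := AlgEquiv.restrictScalarsHom k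
  have hres : Function.Injective res := AlgEquiv.restrictScalarsHom_injective k
  have hlt : (res.comp ρ).range < res.range := by
    refine lt_of_le_of_ne (by rintro _ ⟨g, rfl⟩; exact ⟨ρ g, rfl⟩) fun h ↦ hρ' fun σ ↦ ?_
    obtain ⟨g, hg⟩ : res σ ∈ (res.comp ρ).range := h ▸ ⟨σ, rfl⟩
    exact ⟨g, hres hg⟩
  obtain ⟨A, hA, hdim, ⟨e⟩⟩ := exists_smooth_subalgebra_aut_equiv _ hlt hφ
  exact ⟨A, inferInstance, inferInstance, inferInstance, inferInstance, hA, hdim,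
    ⟨e.trans (MonoidHom.ofInjective (f := res.comp ρ) (hres.comp hρ)).symm⟩⟩
end

section
/- Let k be an algebraically closed field of characteristic zero and let n ≥ 5. Let K be the fraction field of the polynomial ring k[x₁,…,xₙ] and let E ⊆ K be the intermediate field generated over k by the images of the elementary symmetric polynomials s₁, s₂, …, s_{n−1}. Then E is algebraically closed in K: every element of K that is algebraic over E already lies in E. -/
open Polynomial in
/-- If a prime `ℓ` of `R` divides no nonzero element of `S`, then a fraction with numerator
divisible by `ℓ`, denominator not divisible by `ℓ`, and algebraic over `S`, is zero. -/
lemma div_eq_zero_of_prime_dvd_of_isAlgebraic {S R K : Type*} [CommRing S] [CommRing R]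
    [IsDomain R] [Field K] [Algebra S R] [Algebra R K] [Algebra S K] [IsScalarTower S R K]
    [IsFractionRing R K] {ℓ p q : R} (hℓ : Prime ℓ)
    (hS : ∀ s : S, ℓ ∣ algebraMap S R s → s = 0) (hp : ℓ ∣ p) (hq : ¬ ℓ ∣ q)
    (halg : IsAlgebraic S (algebraMap R K p / algebraMap R K q)) :
    algebraMap R K p / algebraMap R K q = 0 := by
  by_contra hb
  have hq0 : q ≠ 0 := by rintro rfl; exact hq (dvd_zero _)
  obtain ⟨f, hf0, hf⟩ := halg.exists_nonzero_coeff_and_aeval_eq_zero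
    (mem_nonZeroDivisors_of_ne_zero hb)
  have h := scaleRoots_aeval_eq_zero_of_aeval_div_eq_zero (IsFractionRing.injective R K)
    (p := f.map (algebraMap S R)) (by rwa [aeval_map_algebraMap])
    (mem_nonZeroDivisors_of_ne_zero hq0)
  rw [aeval_algebraMap_apply, map_eq_zero_iff _ (IsFractionRing.injective R K), coe_aeval_eq_eval,
    ← divX_mul_X_add (scaleRoots _ _), eval_add, eval_mul, eval_X, eval_C, coeff_scaleRoots,
    coeff_map] at h
  have hdvd : ℓ ∣ algebraMap S R (f.coeff 0) * q ^ ((f.map (algebraMap S R)).natDegree - 0) := by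
    rw [eq_neg_of_add_eq_zero_right h]
    exact (hp.mul_left _).neg_right
  rcases hℓ.dvd_or_dvd hdvd with h1 | h1
  · exact hf0 (hS _ h1)
  · exact hq (hℓ.dvd_of_dvd_pow h1)

/-- An `S`-automorphism of `R` that is trivial modulo a prime `ℓ` dividing no nonzero element of
`S` fixes every element of the fraction field of `R` that is algebraic over `S`. -/
lemma algEquivOfAlgEquiv_eq_self_of_isAlgebraic {S R K : Type*} [CommRing S] [IsDomain S]
    [CommRing R] [IsDomain R] [UniqueFactorizationMonoid R] [Field K] [Algebra S R] [Algebra R K]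
    [Algebra S K] [IsScalarTower S R K] [IsFractionRing R K] {ℓ : R} (hℓ : Prime ℓ)
    (hS : ∀ s : S, ℓ ∣ algebraMap S R s → s = 0) (σ : R ≃ₐ[S] R) (hσ : ∀ p, ℓ ∣ p - σ p)
    {a : K} (ha : IsAlgebraic S a) :
    IsFractionRing.algEquivOfAlgEquiv (K := K) (L := K) σ a = a := by
  obtain ⟨p, ⟨q, hq0⟩, hrel, rfl⟩ := IsFractionRing.exists_reduced_fraction R a
  rw [IsFractionRing.mk'_eq_div] at ha ⊢
  have hq0 := nonZeroDivisors.ne_zero hq0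
  have hq : ¬ ℓ ∣ q := by
    intro hq
    have hp : ¬ ℓ ∣ p := fun hp => hℓ.not_isUnit (hrel hp hq)
    have h := div_eq_zero_of_prime_dvd_of_isAlgebraic (K := K) hℓ hS hq hp
      (by simpa using ha.inv)
    rw [div_eq_zero_iff, map_eq_zero_iff _ (IsFractionRing.injective R K),
      map_eq_zero_iff _ (IsFractionRing.injective R K)] at h
    rcases h with rfl | rfl
    · exact hq0 rfl
    · exact hp (dvd_zero _)
  have hσq : ¬ ℓ ∣ σ q := fun h => hq <| by simpa using dvd_add (hσ q) h
  have hq1 : algebraMap R K q ≠ 0 := by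
    rwa [Ne, map_eq_zero_iff _ (IsFractionRing.injective R K)]
  have hσq1 : algebraMap R K (σ q) ≠ 0 := by
    rwa [Ne, map_eq_zero_iff _ (IsFractionRing.injective R K), EmbeddingLike.map_eq_zero_iff]
  have hsub := ha.sub (ha.algHom (IsFractionRing.algEquivOfAlgEquiv (K := K) (L := K) σ).toAlgHom)
  have hdiv : algebraMap R K p / algebraMap R K q -
      IsFractionRing.algEquivOfAlgEquiv (K := K) (L := K) σ
        (algebraMap R K p / algebraMap R K q) =
      algebraMap R K (p * σ q - q * σ p) / algebraMap R K (q * σ q) := by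
    rw [map_div₀, IsFractionRing.algEquivOfAlgEquiv_algebraMap,
      IsFractionRing.algEquivOfAlgEquiv_algebraMap, div_sub_div _ _ hq1 hσq1]
    simp
  have h := div_eq_zero_of_prime_dvd_of_isAlgebraic (K := K) (p := p * σ q - q * σ p)
    (q := q * σ q) hℓ hS ?_ ?_ (hdiv ▸ hsub)
  · rw [← hdiv, sub_eq_zero] at h
    exact h.symm
  · have : p * σ q - q * σ p = q * (p - σ p) - p * (q - σ q) := by ring
    rw [this]
    exact dvd_sub ((hσ p).mul_left _) ((hσ q).mul_left _)
  · exact fun h => (hℓ.dvd_or_dvd h).elim hq hσq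

namespace MvPolynomial

lemma sub_algHom_mem_of_forall_X {ι k : Type*} [CommRing k] (I : Ideal (MvPolynomial ι k))
    (φ : MvPolynomial ι k →ₐ[k] MvPolynomial ι k) (h : ∀ l, X l - φ (X l) ∈ I)
    (p : MvPolynomial ι k) : p - φ p ∈ I := by
  have : Ideal.Quotient.mkₐ k I = (Ideal.Quotient.mkₐ k I).comp φ :=
    algHom_ext fun l => Ideal.Quotient.eq.2 (h l)
  exact Ideal.Quotient.eq.1 (DFunLike.congr_fun this p)

lemma X_sub_X_dvd_sub_rename_swap {ι k : Type*} [DecidableEq ι] [CommRing k] (i j : ι)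
    (p : MvPolynomial ι k) : X i - X j ∣ p - rename (Equiv.swap i j) p := by
  rw [← Ideal.mem_span_singleton]
  refine sub_algHom_mem_of_forall_X _ (rename (Equiv.swap i j)) (fun l => ?_) p
  rw [rename_X, Ideal.mem_span_singleton]
  rcases eq_or_ne l i with rfl | hi
  · simp
  rcases eq_or_ne l j with rfl | hj
  · rw [Equiv.swap_apply_right, ← neg_sub (X l) (X i), neg_dvd]
  · simp [Equiv.swap_apply_of_ne_of_ne hi hj]

lemma prime_X_sub_X {ι k : Type*} [CommRing k] [IsDomain k] {i j : ι} (hij : i ≠ j) :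
    Prime (X i - X j : MvPolynomial ι k) := by
  classical
  let φ : MvPolynomial ι k →ₐ[k] MvPolynomial ι k := aeval (Function.update X i (X j))
  have hφ (p : MvPolynomial ι k) : X i - X j ∣ p ↔ φ p = 0 := by
    constructor
    · rintro ⟨q, rfl⟩
      simp [φ, Function.update_of_ne hij.symm]
    · intro hp
      rw [← Ideal.mem_span_singleton]
      have := sub_algHom_mem_of_forall_X (Ideal.span {X i - X j}) φ (fun l => ?_) p
      · rwa [hp, sub_zero] at this
      · rcases eq_or_ne l i with rfl | hl
        · simp [φ]
        · simp [φ, Function.update_of_ne hl]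
  refine ⟨fun h => hij (X_injective (sub_eq_zero.1 h)), fun h => ?_, fun p q h => ?_⟩
  · simpa using (hφ 1).1 h.dvd
  · rw [hφ, map_mul, mul_eq_zero] at h
    rwa [hφ, hφ]

end MvPolynomial
lemma Equiv.Perm.exists_apply_eq_and_apply_eq {ι : Type*} {i j a b : ι}
    (hij : i ≠ j) (hab : a ≠ b) : ∃ π : Equiv.Perm ι, π i = a ∧ π j = b := by
  classical
  refine ⟨Equiv.swap (Equiv.swap i a j) b * Equiv.swap i a, ?_, by simp⟩
  rw [Equiv.Perm.mul_apply, Equiv.swap_apply_left]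
  refine Equiv.swap_apply_of_ne_of_ne (fun h => hij ?_) hab
  exact (Equiv.swap i a).injective (by rw [← h, Equiv.swap_apply_left])

/-- A multiset of cardinality `n` containing `y` twice can be enumerated with `y` at two
prescribed distinct positions. -/
lemma Multiset.exists_map_univ_eq_of_one_lt_count {α : Type*} [DecidableEq α] {n : ℕ}
    {s : Multiset α} (hs : s.card = n) {y : α} (hy : 1 < s.count y) {i j : Fin n} (hij : i ≠ j) :
    ∃ x : Fin n → α, Finset.univ.val.map x = s ∧ x i = x j := by
  obtain ⟨t, rfl⟩ := Multiset.le_iff_exists_add.1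
    (Multiset.le_count_iff_replicate_le.1 (Nat.succ_le_of_lt hy))
  have hl : Multiset.replicate (Nat.succ 1) y + t = (y :: y :: t.toList : List α) := by
    simp [Multiset.replicate_succ, ← Multiset.cons_coe]
  rw [hl] at hs ⊢
  rw [Multiset.coe_card] at hs
  subst hs
  obtain ⟨π, hi, hj⟩ := Equiv.Perm.exists_apply_eq_and_apply_eq hij
    (a := ⟨0, by simp⟩) (b := ⟨1, by simp⟩) (by simp)
  refine ⟨(y :: y :: t.toList).get ∘ π, ?_, by simp [hi, hj]⟩
  rw [← Multiset.map_map, Multiset.map_univ_val_equiv, Fin.univ_val_map, List.ofFn_get]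

open Polynomial in
/-- Over an algebraically closed field of characteristic zero, the first `n - 1` elementary
symmetric functions take arbitrary values on the hyperplane `xᵢ = xⱼ`. -/
lemma exists_eval_esymm_eq_of_ne {k : Type*} [Field k] [IsAlgClosed k] [CharZero k]
    {n : ℕ} {i j : Fin n} (hij : i ≠ j) (c : Fin (n - 1) → k) :
    ∃ x : Fin n → k, x i = x j ∧
      ∀ m : Fin (n - 1), MvPolynomial.eval x (MvPolynomial.esymm (Fin n) k (m + 1)) = c m := by
  classical
  have hn : 1 < n := by
    by_contra h
    exact hij (Fin.ext (by omega))
  let g : k[X] := ∑ m : Fin (n - 1), C ((-1) ^ ((m : ℕ) + 1) * c m) * X ^ (n - 1 - m)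
  have hg : g.degree < n := by
    refine (degree_sum_le _ _).trans_lt ((Finset.sup_lt_iff (WithBot.bot_lt_coe n)).2 fun m _ => ?_)
    exact (degree_C_mul_X_pow_le _ _).trans_lt (Nat.cast_lt.2 (by omega))
  have hnat {h : k[X]} (hh : h.degree < n) : (X ^ n + h).natDegree = n := by
    refine natDegree_eq_of_degree_eq_some ?_
    rw [degree_add_eq_left_of_degree_lt (by rwa [degree_X_pow]), degree_X_pow]
  have hder : (derivative (X ^ n + g)).degree ≠ 0 := by
    rw [degree_derivative (by rw [hnat hg]; omega), hnat hg]
    exact Nat.cast_ne_zero.2 (by omega)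
  obtain ⟨y, hy⟩ := IsAlgClosed.exists_root _ hder
  let g' : k[X] := g - C (eval y (X ^ n + g))
  have hg' : g'.degree < n := (degree_sub_le _ _).trans_lt
    (max_lt hg (degree_C_le.trans_lt (by exact_mod_cast (by omega : 0 < n))))
  let f : k[X] := X ^ n + g'
  have hmonic : f.Monic := monic_X_pow_add hg'
  have hdeg : f.natDegree = n := hnat hg'
  have hcount : 1 < f.roots.count y := by
    rw [count_roots, one_lt_rootMultiplicity_iff_isRoot hmonic.ne_zero]
    refine ⟨by simp [f, g', IsRoot], ?_⟩
    have : derivative f = derivative (X ^ n + g) := by simp [f, g']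
    rwa [this]
  have hcard : f.roots.card = f.natDegree :=
    splits_iff_card_roots.1 (IsAlgClosed.splits f)
  obtain ⟨x, hx, hxij⟩ := Multiset.exists_map_univ_eq_of_one_lt_count
    (hcard.trans hdeg) hcount hij
  refine ⟨x, hxij, fun m => ?_⟩
  rw [← MvPolynomial.coe_aeval_eq_eval, RingHom.coe_coe,
    MvPolynomial.aeval_esymm_eq_multiset_esymm, hx]
  have hm := coeff_eq_esymm_roots_of_card hcard (k := n - (m + 1)) (by omega)
  have hcoeff : f.coeff (n - (m + 1)) = (-1) ^ ((m : ℕ) + 1) * c m := by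
    simp only [f, g', g, coeff_add, coeff_sub, finsetSum_coeff, coeff_C_mul, coeff_X_pow, coeff_C]
    rw [if_neg (by omega), if_neg (by omega), Finset.sum_eq_single m]
    · simp [Nat.sub_sub, add_comm]
    · intro b _ hb
      rw [if_neg, mul_zero]
      have := Fin.val_ne_iff.2 hb
      omega
    · simp
  rw [hcoeff, hmonic.leadingCoeff, one_mul, hdeg, Nat.sub_sub_self (by omega)] at hm
  exact (mul_left_cancel₀ (pow_ne_zero _ (by simp)) hm).symm

/-- A polynomial in the first `n - 1` elementary symmetric polynomials that is divisible by
`xᵢ - xⱼ` is zero. -/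
lemma eq_zero_of_X_sub_X_dvd_of_mem_adjoin_esymm {k : Type*} [Field k] [IsAlgClosed k] [CharZero k]
    {n : ℕ} {i j : Fin n} (hij : i ≠ j) {s : MvPolynomial (Fin n) k}
    (hs : s ∈ Algebra.adjoin k (Set.range fun m : Fin (n - 1) =>
      MvPolynomial.esymm (Fin n) k (m + 1)))
    (h : MvPolynomial.X i - MvPolynomial.X j ∣ s) : s = 0 := by
  rw [Algebra.adjoin_range_eq_range_aeval] at hs
  obtain ⟨P, rfl⟩ := hs
  suffices P = 0 by simp [this]
  refine MvPolynomial.funext fun c => ?_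
  obtain ⟨x, hx, hc⟩ := exists_eval_esymm_eq_of_ne hij c
  obtain ⟨q, hq⟩ := h
  have hq := congr_arg (MvPolynomial.aeval x) hq
  change MvPolynomial.aeval x (MvPolynomial.aeval _ P) = _ at hq
  have hcomp : (MvPolynomial.aeval x).comp (MvPolynomial.aeval fun m : Fin (n - 1) =>
      MvPolynomial.esymm (Fin n) k (m + 1)) = MvPolynomial.aeval (R := k) c :=
    MvPolynomial.algHom_ext fun m => by simpa [MvPolynomial.aeval_eq_eval] using hc m
  rw [← AlgHom.comp_apply, hcomp] at hq
  simpa [hx, MvPolynomial.aeval_eq_eval] using hq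

/-- A fraction of polynomials that is invariant under all permutations of the variables is a
fraction of symmetric polynomials. -/
lemma exists_isSymmetric_div_eq_of_forall_rename {ι k K : Type*} [Finite ι] [Field k] [Field K]
    [Algebra (MvPolynomial ι k) K] [IsFractionRing (MvPolynomial ι k) K]
    {p q : MvPolynomial ι k} (hq : q ≠ 0)
    (h : ∀ e : Equiv.Perm ι, p * MvPolynomial.rename e q = q * MvPolynomial.rename e p) :
    ∃ a b : MvPolynomial ι k, a.IsSymmetric ∧ b.IsSymmetric ∧
      algebraMap _ K p / algebraMap _ K q = algebraMap _ K a / algebraMap _ K b := by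
  classical
  have := Fintype.ofFinite ι
  have hne (e : Equiv.Perm ι) : MvPolynomial.rename e q ≠ 0 := fun h0 =>
    hq (MvPolynomial.rename_injective e e.injective (by rw [h0, map_zero]))
  set b : MvPolynomial ι k := ∏ e : Equiv.Perm ι, MvPolynomial.rename e q with hb
  have hb0 : b ≠ 0 := Finset.prod_ne_zero_iff.2 fun e _ => hne e
  have hbs : b.IsSymmetric := fun f => by
    rw [hb, map_prod]
    simp_rw [MvPolynomial.rename_rename]
    exact Fintype.prod_equiv (Equiv.mulLeft f) _ _ fun e => rfl
  obtain ⟨c, hc⟩ : q ∣ b := by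
    simpa using Finset.dvd_prod_of_mem (fun e : Equiv.Perm ι => MvPolynomial.rename e q)
      (Finset.mem_univ 1)
  have hpc : q * (p * c) = p * b := by rw [hc]; ring
  refine ⟨p * c, b, fun f => ?_, hbs, ?_⟩
  · have hf := congr_arg (MvPolynomial.rename f) hpc
    simp only [map_mul, hbs f] at hf ⊢
    refine mul_left_cancel₀ (mul_ne_zero hq (hne f)) ?_
    linear_combination q * hf - b * h f - MvPolynomial.rename f q * hpc
  · have inj := IsFractionRing.injective (MvPolynomial ι k) K
    rw [div_eq_div_iff (by rwa [Ne, map_eq_zero_iff _ inj]) (by rwa [Ne, map_eq_zero_iff _ inj]),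
      ← map_mul, ← map_mul, ← hpc, mul_comm q]

/-- A field is algebraically closed in a simple transcendental extension. -/
lemma IntermediateField.mem_range_algebraMap_of_mem_adjoin_simple_of_transcendental {F K : Type*}
    [Field F] [Field K] [Algebra F K] {t a : K} (ht : Transcendental F t)
    (hat : a ∈ IntermediateField.adjoin F {t}) (ha : IsAlgebraic F a) :
    a ∈ (algebraMap F K).range := by
  let φ := RatFunc.algEquivOfTranscendental t ht
  have ha' : IsAlgebraic F (⟨a, hat⟩ : IntermediateField.adjoin F {t}) :=
    (isAlgebraic_algebraMap_iff
      (FaithfulSMul.algebraMap_injective (IntermediateField.adjoin F {t}) K)).1 ha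
  have hφ : IsAlgebraic F (φ.symm ⟨a, hat⟩) := ha'.algHom φ.symm.toAlgHom
  obtain ⟨c, hc⟩ := not_not.1 fun h => RatFunc.transcendental_of_ne_C _ h hφ
  refine ⟨c, ?_⟩
  rw [AlgEquiv.symm_apply_eq, ← RatFunc.algebraMap_eq_C, AlgEquiv.commutes] at hc
  exact (congr_arg Subtype.val hc).symm

/-- An element of `k(x₁,…,xₙ)` that is algebraic over the algebra generated by the first `n - 1`
elementary symmetric polynomials is fixed by every permutation of the variables. -/
lemma mul_rename_eq_of_isAlgebraic_adjoin_esymm {k K : Type*} [Field k] [IsAlgClosed k]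
    [CharZero k] {n : ℕ} [Field K] [Algebra (MvPolynomial (Fin n) k) K]
    [IsFractionRing (MvPolynomial (Fin n) k) K] {p q : MvPolynomial (Fin n) k} (hq : q ≠ 0)
    (ha : IsAlgebraic (Algebra.adjoin k (Set.range fun m : Fin (n - 1) =>
      MvPolynomial.esymm (Fin n) k (m + 1))) (algebraMap _ K p / algebraMap _ K q))
    (e : Equiv.Perm (Fin n)) :
    p * MvPolynomial.rename e q = q * MvPolynomial.rename e p := by
  set S := Algebra.adjoin k (Set.range fun m : Fin (n - 1) =>
      MvPolynomial.esymm (Fin n) k (m + 1))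
  have inj := IsFractionRing.injective (MvPolynomial (Fin n) k) K
  have hfix (f : Equiv.Perm (Fin n)) (s : S) : MvPolynomial.rename f (s : MvPolynomial (Fin n) k) =
      s := by
    have hle : S ≤ MvPolynomial.symmetricSubalgebra (Fin n) k := Algebra.adjoin_le <| by
      rintro _ ⟨m, rfl⟩
      exact MvPolynomial.esymm_isSymmetric _ _ _
    exact (MvPolynomial.mem_symmetricSubalgebra _).1 (hle s.2) f
  induction e using Equiv.Perm.swap_induction_on with
  | one => simp [mul_comm]
  | swap_mul f i j hij ih =>
    let σ : MvPolynomial (Fin n) k ≃ₐ[S] MvPolynomial (Fin n) k :=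
      AlgEquiv.ofRingEquiv (f := (MvPolynomial.renameEquiv k (Equiv.swap i j)).toRingEquiv)
        (hfix (Equiv.swap i j))
    have hσ (r : MvPolynomial (Fin n) k) : σ r = MvPolynomial.rename (Equiv.swap i j) r := rfl
    have h := algEquivOfAlgEquiv_eq_self_of_isAlgebraic (MvPolynomial.prime_X_sub_X hij)
      (fun s hs => Subtype.ext (eq_zero_of_X_sub_X_dvd_of_mem_adjoin_esymm hij s.2 hs)) σ
      (MvPolynomial.X_sub_X_dvd_sub_rename_swap i j) ha
    have hσq : σ q ≠ 0 := by simpa using hq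
    rw [map_div₀, IsFractionRing.algEquivOfAlgEquiv_algebraMap,
      IsFractionRing.algEquivOfAlgEquiv_algebraMap,
      div_eq_div_iff (by rwa [Ne, map_eq_zero_iff _ inj]) (by rwa [Ne, map_eq_zero_iff _ inj]),
      ← map_mul, ← map_mul, inj.eq_iff] at h
    have ih' := congr_arg σ ih
    simp only [map_mul] at ih'
    rw [Equiv.Perm.coe_mul, ← MvPolynomial.rename_rename, ← MvPolynomial.rename_rename, ← hσ, ← hσ]
    refine mul_left_cancel₀ hσq ?_
    linear_combination q * ih' - σ (MvPolynomial.rename f q) * h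

/-- Symmetric polynomials lie in the subalgebra of the fraction field generated by the elementary
symmetric polynomials. -/
lemma algebraMap_mem_adjoin_esymm_of_isSymmetric {k K : Type*} [Field k] {n : ℕ} [Field K]
    [Algebra (MvPolynomial (Fin n) k) K] [Algebra k K]
    [IsScalarTower k (MvPolynomial (Fin n) k) K] {p : MvPolynomial (Fin n) k}
    (hp : p.IsSymmetric) :
    algebraMap _ K p ∈ Algebra.adjoin k (Set.range fun m : Fin n =>
      algebraMap _ K (MvPolynomial.esymm (Fin n) k (m + 1))) := by
  obtain ⟨P, hP⟩ := MvPolynomial.esymmAlgHom_surjective (σ := Fin n) (n := n) k (by simp) ⟨p, hp⟩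
  have hP := congr_arg Subtype.val hP
  rw [MvPolynomial.esymmAlgHom_apply] at hP
  rw [Algebra.adjoin_range_eq_range_aeval]
  exact ⟨P, (MvPolynomial.aeval_algebraMap_apply K _ P).trans (congr_arg _ hP)⟩

lemma algebraicIndependent_algebraMap_esymm {k K : Type*} [Field k] {n : ℕ} [Field K]
    [Algebra (MvPolynomial (Fin n) k) K] [IsFractionRing (MvPolynomial (Fin n) k) K] [Algebra k K]
    [IsScalarTower k (MvPolynomial (Fin n) k) K] :
    AlgebraicIndependent k fun m : Fin n =>
      algebraMap _ K (MvPolynomial.esymm (Fin n) k (m + 1)) := by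
  have h : AlgebraicIndependent k fun m : Fin n => MvPolynomial.esymm (Fin n) k (m + 1) := by
    intro P Q h
    refine MvPolynomial.esymmAlgHom_injective (σ := Fin n) (n := n) k (by simp) (Subtype.ext ?_)
    rwa [MvPolynomial.esymmAlgHom_apply, MvPolynomial.esymmAlgHom_apply]
  exact h.map' (f := IsScalarTower.toAlgHom k (MvPolynomial (Fin n) k) K)
    (IsFractionRing.injective _ K)


/-- For `n ≥ 5`, the subfield `E = k(s₁,…,s_{n-1})` of the rational function field
`K = k(x₁,…,xₙ)` generated by the first `n-1` elementary symmetric polynomials is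
algebraically closed in `K`. -/
theorem subfield_of_elementary_symmetric_isAlgClosed_in_fractionField
    (k : Type) [Field k] [IsAlgClosed k] [CharZero k]
    (n : ℕ) (hn : 5 ≤ n)
    (K : Type) [Field K] [Algebra (MvPolynomial (Fin n) k) K]
    [IsFractionRing (MvPolynomial (Fin n) k) K]
    [Algebra k K] [IsScalarTower k (MvPolynomial (Fin n) k) K]
    (E : IntermediateField k K)
    (hE : E = IntermediateField.adjoin k
      ((fun j : Fin (n - 1) =>
          algebraMap (MvPolynomial (Fin n) k) K
            (MvPolynomial.esymm (Fin n) k ((j : ℕ) + 1))) '' Set.univ)) :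
    ∀ x : K, IsAlgebraic E x → x ∈ E := by
  intro x hx
  obtain ⟨n, rfl⟩ : ∃ m, n = m + 1 := ⟨n - 1, by omega⟩
  set s : Fin (n + 1) → K := fun m =>
    algebraMap _ K (MvPolynomial.esymm (Fin (n + 1)) k (m + 1))
  rw [Set.image_univ] at hE
  have hT : Set.range (fun j : Fin (n + 1 - 1) => algebraMap (MvPolynomial (Fin (n + 1)) k) K
      (MvPolynomial.esymm (Fin (n + 1)) k ((j : ℕ) + 1))) =
      IsScalarTower.toAlgHom k (MvPolynomial (Fin (n + 1)) k) K ''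
        Set.range fun m : Fin (n + 1 - 1) => MvPolynomial.esymm (Fin (n + 1)) k (m + 1) := by
    rw [← Set.range_comp]
    rfl
  have hTs : Set.range (fun j : Fin (n + 1 - 1) => algebraMap (MvPolynomial (Fin (n + 1)) k) K
      (MvPolynomial.esymm (Fin (n + 1)) k ((j : ℕ) + 1))) = s '' {Fin.last n}ᶜ := by
    have hlast : Set.range (Fin.castSucc : Fin n → Fin (n + 1)) = {Fin.last n}ᶜ :=
      Set.ext fun _ => Fin.exists_castSucc_eq
    rw [← hlast, ← Set.range_comp]
    rfl
  have hxS : IsAlgebraic (Algebra.adjoin k (Set.range fun m : Fin (n + 1 - 1) =>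
      MvPolynomial.esymm (Fin (n + 1)) k (m + 1))) x := by
    have h := hx
    rw [hE, IntermediateField.isAlgebraic_adjoin_iff, hT, ← AlgHom.map_adjoin] at h
    exact h.of_ringHom_of_comp_eq (AlgHom.subalgebraMap _ _) (RingHom.id K)
      (AlgHom.subalgebraMap_surjective _ _) Function.injective_id rfl
  have ht : Transcendental E (s (Fin.last n)) := by
    rw [hE, hTs, Transcendental, IntermediateField.isAlgebraic_adjoin_iff]
    exact algebraicIndependent_algebraMap_esymm.transcendental_adjoin (by simp)
  have hadj : Algebra.adjoin k (Set.range s) ≤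
      ((IntermediateField.adjoin E {s (Fin.last n)}).restrictScalars k).toSubalgebra := by
    refine Algebra.adjoin_le ?_
    rintro _ ⟨m, rfl⟩
    rcases eq_or_ne m (Fin.last n) with rfl | hm
    · exact IntermediateField.mem_adjoin_simple_self E _
    · have hmE : s m ∈ E := by
        rw [hE, hTs]
        exact IntermediateField.subset_adjoin _ _ ⟨m, hm, rfl⟩
      exact (IntermediateField.adjoin E {s (Fin.last n)}).algebraMap_mem ⟨s m, hmE⟩
  obtain ⟨p, q, hq, rfl⟩ := IsFractionRing.div_surjective (A := MvPolynomial (Fin (n + 1)) k) x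
  obtain ⟨a, b, ha, hb, hab⟩ := exists_isSymmetric_div_eq_of_forall_rename (K := K)
    (nonZeroDivisors.ne_zero hq)
    (mul_rename_eq_of_isAlgebraic_adjoin_esymm (nonZeroDivisors.ne_zero hq) hxS)
  have hmem : algebraMap _ K p / algebraMap _ K q ∈
      IntermediateField.adjoin E {s (Fin.last n)} := by
    rw [hab]
    exact div_mem (hadj (algebraMap_mem_adjoin_esymm_of_isSymmetric ha))
      (hadj (algebraMap_mem_adjoin_esymm_of_isSymmetric hb))
  obtain ⟨c, hc⟩ :=
    IntermediateField.mem_range_algebraMap_of_mem_adjoin_simple_of_transcendental ht hmem hx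
  rw [← hc]
  exact c.2
end
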